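/- Let W be a d-dimensional Brownian sheet on [0,1]^2 and let b : [0,1]^2 × ℝ^d → ℝ be Borel measurable with |b(s,t,x)| ≤ 1 everywhere. Then there exist a set Ω₁ ⊂ Ω with ℙ(Ω₁) = 1 and a positive random variable C₁ such that for all ω ∈ Ω₁, all dyadic points x, y ∈ [−1,1]^d, and all integers n ≥ 1, 0 ≤ k, k' ≤ 2^n − 1, one has |ϱ_{nkk'}(x,y)(ω)| ≤ C₁(ω) 2^{−n} [ √n + (log⁺(1/|x−y|))^{1/2} ] |x−y|. -/

import Mathlib

open MeasureTheory ProbabilityTheory Set Filter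

noncomputable section

/-- A `d`-dimensional Brownian sheet on `[0,1]²`. -/
def IsBrownianSheet {Ω : Type*} [MeasurableSpace Ω] (P : Measure Ω) (d : ℕ)
    (W : ℝ × ℝ → Ω → EuclideanSpace ℝ (Fin d)) : Prop :=
  (∀ p, Measurable (W p)) ∧
  (∀ ω, ContinuousOn (fun p => W p ω) (Set.Icc (0 : ℝ × ℝ) 1)) ∧
  (∀ ω, ∀ p ∈ Set.Icc (0 : ℝ × ℝ) 1, p.1 = 0 ∨ p.2 = 0 → W p ω = 0) ∧
  (∀ (n : ℕ) (p : Fin n → ℝ × ℝ) (idx : Fin n → Fin d) (c : Fin n → ℝ),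
    (∀ j, p j ∈ Set.Icc (0 : ℝ × ℝ) 1) →
    P.map (fun ω => ∑ j, c j * W (p j) ω (idx j)) =
      gaussianReal 0 (∑ j, ∑ k, c j * c k *
        (if idx j = idx k then min (p j).1 (p k).1 * min (p j).2 (p k).2 else 0)).toNNReal)

/-- The σ-algebra generated by the sheet up to `p`. -/
def sheetSigma {Ω : Type*} [MeasurableSpace Ω] {d : ℕ}
    (W : ℝ × ℝ → Ω → EuclideanSpace ℝ (Fin d)) (p : ℝ × ℝ) : MeasurableSpace Ω :=
  ⨆ q ∈ Set.Icc (0 : ℝ × ℝ) p, MeasurableSpace.comap (W q) inferInstance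

/-- A strong solution of the sheet SDE. -/
def IsStrongSolution {Ω : Type*} [MeasurableSpace Ω] (P : Measure Ω) {d : ℕ}
    (W : ℝ × ℝ → Ω → EuclideanSpace ℝ (Fin d))
    (b : ℝ × ℝ → EuclideanSpace ℝ (Fin d) → EuclideanSpace ℝ (Fin d))
    (ξ : EuclideanSpace ℝ (Fin d))
    (X : ℝ × ℝ → Ω → EuclideanSpace ℝ (Fin d)) : Prop :=
  (∀ ω, ContinuousOn (fun p => X p ω) (Set.Icc (0 : ℝ × ℝ) 1)) ∧
  (∀ p ∈ Set.Icc (0 : ℝ × ℝ) 1, ∃ Y : Ω → EuclideanSpace ℝ (Fin d),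
      Measurable[sheetSigma W p] Y ∧ ∀ᵐ ω ∂P, X p ω = Y ω) ∧
  (∀ᵐ ω ∂P, ∀ p ∈ Set.Icc (0 : ℝ × ℝ) 1,
      X p ω = ξ + (∫ t₁ in (0:ℝ)..p.2, ∫ s₁ in (0:ℝ)..p.1, b (s₁, t₁) (X (s₁, t₁) ω)) + W p ω)

/-- A point of `ℝ^d` is dyadic if all its coordinates are dyadic rationals. -/
def IsDyadicPoint {d : ℕ} (x : EuclideanSpace ℝ (Fin d)) : Prop :=
  ∀ i, ∃ (m : ℤ) (l : ℕ), x i = (m : ℝ) / 2 ^ l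

/-- The nearest point of `[0,1]`. -/
def unitClamp (x : ℝ) : ℝ := max 0 (min x 1)

lemma unitClamp_nonneg (x : ℝ) : 0 ≤ unitClamp x := le_max_left _ _

lemma unitClamp_le_one (x : ℝ) : unitClamp x ≤ 1 := by simp [unitClamp]

lemma unitClamp_eq_self {x : ℝ} (h0 : 0 ≤ x) (h1 : x ≤ 1) : unitClamp x = x := by
  simp [unitClamp, h0, h1]

lemma unitClamp_mono : Monotone unitClamp := fun x y h => by
  unfold unitClamp; gcongr

@[fun_prop]
lemma continuous_unitClamp : Continuous unitClamp := by
  unfold unitClamp; fun_prop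

/-- The nearest point of the unit square. -/
def squareClamp (p : ℝ × ℝ) : ℝ × ℝ := (unitClamp p.1, unitClamp p.2)

@[fun_prop]
lemma continuous_squareClamp : Continuous squareClamp := by
  unfold squareClamp; fun_prop

lemma squareClamp_mem (p : ℝ × ℝ) : squareClamp p ∈ Set.Icc (0 : ℝ × ℝ) 1 :=
  ⟨⟨unitClamp_nonneg _, unitClamp_nonneg _⟩, ⟨unitClamp_le_one _, unitClamp_le_one _⟩⟩

lemma squareClamp_eq_self {p : ℝ × ℝ} (hp : p ∈ Set.Icc (0 : ℝ × ℝ) 1) : squareClamp p = p := by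
  ext
  · exact unitClamp_eq_self hp.1.1 hp.2.1
  · exact unitClamp_eq_self hp.1.2 hp.2.2

section Sheet

variable {Ω : Type*} [MeasurableSpace Ω] {P : Measure Ω} {d : ℕ}
  {W : ℝ × ℝ → Ω → EuclideanSpace ℝ (Fin d)}

/-- The covariance of the coordinates of a Brownian sheet. -/
def sheetCov {d : ℕ} (q r : (ℝ × ℝ) × Fin d) : ℝ :=
  if q.2 = r.2 then min (squareClamp q.1).1 (squareClamp r.1).1 *
    min (squareClamp q.1).2 (squareClamp r.1).2 else 0

lemma sheetCov_nonneg (q r : (ℝ × ℝ) × Fin d) : 0 ≤ sheetCov q r := by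
  unfold sheetCov
  split_ifs
  · exact mul_nonneg (le_min (unitClamp_nonneg _) (unitClamp_nonneg _))
      (le_min (unitClamp_nonneg _) (unitClamp_nonneg _))
  · rfl

lemma IsBrownianSheet.map_sum (hW : IsBrownianSheet P d W) {ι : Type*} [Fintype ι]
    (q : ι → (ℝ × ℝ) × Fin d) (c : ι → ℝ) :
    P.map (fun ω => ∑ j, c j * W (squareClamp (q j).1) ω (q j).2) =
      gaussianReal 0 (∑ j, ∑ k, c j * c k * sheetCov (q j) (q k)).toNNReal := by
  have e := Fintype.equivFin ι
  have := hW.2.2.2 (Fintype.card ι) (fun j => squareClamp (q (e.symm j)).1)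
    (fun j => (q (e.symm j)).2) (fun j => c (e.symm j)) (fun j => squareClamp_mem _)
  convert! this using 3
  · rw [← e.symm.sum_comp]
  · rw [← e.symm.sum_comp]
    refine Finset.sum_congr rfl fun j _ => ?_
    rw [← e.symm.sum_comp]
    rfl

lemma IsBrownianSheet.measurable_coord (hW : IsBrownianSheet P d W) (q : (ℝ × ℝ) × Fin d) :
    Measurable fun ω => W (squareClamp q.1) ω q.2 := by
  have := hW.1 (squareClamp q.1)
  fun_prop

lemma IsBrownianSheet.isGaussianProcess (hW : IsBrownianSheet P d W) :
    IsGaussianProcess (fun (q : (ℝ × ℝ) × Fin d) ω => W (squareClamp q.1) ω q.2) P where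
  hasGaussianLaw I := by
    refine ⟨isGaussian_of_map_eq_gaussianReal fun L => ⟨0,
      (∑ j : I, ∑ k : I, L (Pi.single j 1) * L (Pi.single k 1) * sheetCov j.1 k.1).toNNReal, ?_⟩⟩
    · have hm : Measurable fun ω => I.restrict fun q : (ℝ × ℝ) × Fin d =>
          W (squareClamp q.1) ω q.2 := by
        refine measurable_pi_lambda _ fun q => hW.measurable_coord q.1
      rw [Measure.map_map (by fun_prop) hm,
        ← hW.map_sum (fun j : I => j.1) (fun j => L (Pi.single j 1))]
      congr 1
      ext ω
      simp only [Function.comp]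
      conv_lhs => rw [← L.sum_comp_single]
      refine Finset.sum_congr rfl fun j _ => ?_
      have : (Pi.single j (W (squareClamp j.1.1) ω j.1.2) : I → ℝ)
        = W (squareClamp j.1.1) ω j.1.2 • Pi.single j 1 := by
        rw [← Pi.single_smul]; simp
      simp [this, mul_comm]

lemma IsBrownianSheet.map_eval (hW : IsBrownianSheet P d W) (q : (ℝ × ℝ) × Fin d) :
    P.map (fun ω => W (squareClamp q.1) ω q.2) = gaussianReal 0 (sheetCov q q).toNNReal := by
  simpa using hW.map_sum (fun _ : Unit => q) (fun _ => 1)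

lemma integral_eq_zero_of_map_gaussianReal {X : Ω → ℝ} {v : NNReal}
    (hX : Measurable X) (h : P.map X = gaussianReal 0 v) : ∫ ω, X ω ∂P = 0 := by
  have := integral_map (μ := P) hX.aemeasurable (f := fun x : ℝ => x) (by fun_prop)
  rw [← this, h, integral_id_gaussianReal]

lemma variance_eq_of_map_gaussianReal {X : Ω → ℝ} {v : NNReal}
    (hX : Measurable X) (h : P.map X = gaussianReal 0 v) : Var[X; P] = v := by
  rw [← variance_id_map hX.aemeasurable, h, variance_id_gaussianReal]

lemma memLp_of_map_gaussianReal {X : Ω → ℝ} {v : NNReal}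
    (hX : Measurable X) (h : P.map X = gaussianReal 0 v) (p : NNReal) : MemLp X p P := by
  have h1 := memLp_id_gaussianReal (μ := 0) (v := v) p
  rw [← h] at h1
  exact (memLp_map_measure_iff (by fun_prop) hX.aemeasurable).1 h1

lemma IsBrownianSheet.integral_eval (hW : IsBrownianSheet P d W) (q : (ℝ × ℝ) × Fin d) :
    ∫ ω, W (squareClamp q.1) ω q.2 ∂P = 0 :=
  integral_eq_zero_of_map_gaussianReal (hW.measurable_coord q) (hW.map_eval q)

lemma IsBrownianSheet.covariance_eval [IsProbabilityMeasure P] (hW : IsBrownianSheet P d W)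
    (q r : (ℝ × ℝ) × Fin d) :
    cov[fun ω => W (squareClamp q.1) ω q.2, fun ω => W (squareClamp r.1) ω r.2; P] =
      sheetCov q r := by
  have hq := hW.map_eval q
  have hr := hW.map_eval r
  have hs : P.map (fun ω => W (squareClamp q.1) ω q.2 + W (squareClamp r.1) ω r.2)
      = gaussianReal 0 (sheetCov q q + sheetCov q r + (sheetCov r q + sheetCov r r)).toNNReal := by
    simpa [Fin.sum_univ_two] using hW.map_sum ![q, r] (fun _ => 1)
  have hqr : sheetCov r q = sheetCov q r := by
    simp [sheetCov, min_comm, eq_comm]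
  have mq := hW.measurable_coord q
  have mr := hW.measurable_coord r
  have vs := variance_eq_of_map_gaussianReal (mq.add mr) hs
  have vq := variance_eq_of_map_gaussianReal mq hq
  have vr := variance_eq_of_map_gaussianReal mr hr
  have := variance_add (by simpa using memLp_of_map_gaussianReal mq hq 2)
    (by simpa using memLp_of_map_gaussianReal mr hr 2)
  rw [vs, vq, vr, Real.coe_toNNReal _ (sheetCov_nonneg q q),
    Real.coe_toNNReal _ (sheetCov_nonneg r r), Real.coe_toNNReal, hqr] at this
  · linarith
  · have := sheetCov_nonneg q q; have := sheetCov_nonneg q r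
    have := sheetCov_nonneg r q; have := sheetCov_nonneg r r
    positivity

end Sheet

section GaussianTools

variable {Ω : Type*} [MeasurableSpace Ω] {P : Measure Ω}

lemma lintegral_exp_mul_gaussianReal (v : NNReal) (θ : ℝ) :
    ∫⁻ x, ENNReal.ofReal (Real.exp (θ * x)) ∂(gaussianReal 0 v) =
      ENNReal.ofReal (Real.exp (θ ^ 2 * v / 2)) := by
  rw [← ofReal_integral_eq_lintegral_ofReal (integrable_exp_mul_gaussianReal θ)
    (ae_of_all _ fun _ => (Real.exp_pos _).le)]
  have := congrFun (mgf_fun_id_gaussianReal (μ := 0) (v := v)) θ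
  simp only [mgf] at this
  rw [this]
  congr 2
  ring

lemma lintegral_exp_mul_of_map_gaussianReal {X : Ω → ℝ} {v : NNReal} (hX : Measurable X)
    (h : P.map X = gaussianReal 0 v) (θ : ℝ) :
    ∫⁻ ω, ENNReal.ofReal (Real.exp (θ * X ω)) ∂P = ENNReal.ofReal (Real.exp (θ ^ 2 * v / 2)) := by
  rw [← lintegral_exp_mul_gaussianReal, ← h, lintegral_map (by fun_prop) hX]

lemma lintegral_exp_mul_abs_le {X : Ω → ℝ} {v : NNReal} (hX : Measurable X)
    (h : P.map X = gaussianReal 0 v) (θ : ℝ) :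
    ∫⁻ ω, ENNReal.ofReal (Real.exp (θ * |X ω|)) ∂P ≤
      2 * ENNReal.ofReal (Real.exp (θ ^ 2 * v / 2)) := by
  calc ∫⁻ ω, ENNReal.ofReal (Real.exp (θ * |X ω|)) ∂P
      ≤ ∫⁻ ω, (ENNReal.ofReal (Real.exp (θ * X ω)) + ENNReal.ofReal (Real.exp (-θ * X ω))) ∂P := by
        refine lintegral_mono fun ω => ?_
        rw [← ENNReal.ofReal_add (Real.exp_pos _).le (Real.exp_pos _).le]
        refine ENNReal.ofReal_le_ofReal ?_
        have h1 := Real.exp_pos (θ * X ω)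
        have h2 := Real.exp_pos (-θ * X ω)
        rcases abs_cases (X ω) with ⟨e, _⟩ | ⟨e, _⟩ <;> rw [e]
        · linarith
        · rw [mul_neg, ← neg_mul]; linarith
    _ = _ := by
        rw [lintegral_add_left (by fun_prop), lintegral_exp_mul_of_map_gaussianReal hX h,
          lintegral_exp_mul_of_map_gaussianReal hX h, neg_sq, two_mul]

lemma lintegral_exp_add_mul_le [IsProbabilityMeasure P] {H φ ξ : Ω → ℝ} {v : NNReal} {K : ℝ}
    (hH : Measurable H) (hφ : Measurable φ) (hξ : Measurable ξ) (hK : ∀ ω, |φ ω| ≤ K)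
    (hind : IndepFun (fun ω => (H ω, φ ω)) ξ P) (h : P.map ξ = gaussianReal 0 v) :
    ∫⁻ ω, ENNReal.ofReal (Real.exp (H ω + φ ω * ξ ω)) ∂P ≤
      ENNReal.ofReal (Real.exp (K ^ 2 * v / 2)) * ∫⁻ ω, ENNReal.ofReal (Real.exp (H ω)) ∂P := by
  have hm := (indepFun_iff_map_prod_eq_prod_map_map (hH.prodMk hφ).aemeasurable
    hξ.aemeasurable).1 hind
  have e1 : ∫⁻ ω, ENNReal.ofReal (Real.exp (H ω + φ ω * ξ ω)) ∂P =
      ∫⁻ z, ENNReal.ofReal (Real.exp (z.1.1 + z.1.2 * z.2))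
        ∂(P.map fun ω => ((H ω, φ ω), ξ ω)) := by
    rw [lintegral_map (by fun_prop) (by fun_prop)]
  rw [e1, hm, h, lintegral_prod _ (by fun_prop), lintegral_map (by fun_prop) (by fun_prop),
    ← lintegral_const_mul _ (by fun_prop)]
  refine lintegral_mono fun ω => ?_
  simp only
  simp_rw [Real.exp_add, ENNReal.ofReal_mul (Real.exp_pos _).le]
  rw [lintegral_const_mul _ (by fun_prop), lintegral_exp_mul_gaussianReal, mul_comm]
  have hsq := sq_le_sq' (abs_le.1 (hK ω)).1 (abs_le.1 (hK ω)).2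
  gcongr

lemma lintegral_exp_sum_le [IsProbabilityMeasure P] {φ ξ : ℕ → Ω → ℝ} {v : ℕ → NNReal} {K : ℝ}
    (hφ : ∀ i, Measurable (φ i)) (hξ : ∀ i, Measurable (ξ i)) (hK : ∀ i ω, |φ i ω| ≤ K) (N : ℕ)
    (hind : ∀ i < N, IndepFun (fun ω => (∑ j ∈ Finset.range i, φ j ω * ξ j ω, φ i ω)) (ξ i) P)
    (h : ∀ i < N, P.map (ξ i) = gaussianReal 0 (v i)) (θ : ℝ) :
    ∫⁻ ω, ENNReal.ofReal (Real.exp (θ * ∑ i ∈ Finset.range N, φ i ω * ξ i ω)) ∂P ≤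
      ENNReal.ofReal (Real.exp (θ ^ 2 * K ^ 2 * (∑ i ∈ Finset.range N, (v i : ℝ)) / 2)) := by
  induction N with
  | zero => simp
  | succ n ih =>
    have := ih (fun i hi => hind i (by omega)) (fun i hi => h i (by omega))
    have hi : IndepFun (fun ω => (θ * ∑ j ∈ Finset.range n, φ j ω * ξ j ω, θ * φ n ω)) (ξ n) P :=
      (hind n (by omega)).comp (φ := fun z : ℝ × ℝ => (θ * z.1, θ * z.2)) (ψ := id)
        (by fun_prop) measurable_id
    have step := lintegral_exp_add_mul_le (K := |θ| * K) (by fun_prop) (by fun_prop) (hξ n)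
      (fun ω => by rw [abs_mul]; exact mul_le_mul_of_nonneg_left (hK n ω) (abs_nonneg _))
      hi (h n (by omega))
    simp_rw [Finset.sum_range_succ, mul_add, ← mul_assoc] at step ⊢
    refine step.trans ((mul_le_mul_right this _).trans ?_)
    rw [← ENNReal.ofReal_mul (Real.exp_pos _).le, ← Real.exp_add, mul_pow, sq_abs]
    refine le_of_eq ?_
    congr 2
    ring

lemma integral_comp_of_map_gaussianReal {X : Ω → ℝ} {v : NNReal} (hX : Measurable X)
    (h : P.map X = gaussianReal 0 v) {f : ℝ → ℝ} (hf : Measurable f) :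
    ∫ ω, f (X ω) ∂P = ∫ x, f (Real.sqrt v * x) ∂(gaussianReal 0 1) := by
  have e : gaussianReal 0 v = (gaussianReal 0 1).map (fun x => Real.sqrt v * x) := by
    rw [gaussianReal_map_const_mul]
    congr 1
    · simp
    · ext; simp
  rw [← integral_map (φ := X) hX.aemeasurable (by fun_prop), h, e,
    integral_map (by fun_prop) (by fun_prop)]

/-- The variance of the square of a standard Gaussian variable. -/
def gaussianSqVar : ℝ := ∫ x, (x ^ 2 - 1) ^ 2 ∂(gaussianReal 0 1)

/-- The fourth moment of a standard Gaussian variable. -/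
def gaussianFourth : ℝ := ∫ x, x ^ 4 ∂(gaussianReal 0 1)

lemma integral_sq_sub_sq_of_map_gaussianReal {X : Ω → ℝ} {v : NNReal} (hX : Measurable X)
    (h : P.map X = gaussianReal 0 v) : ∫ ω, (X ω ^ 2 - v) ^ 2 ∂P = gaussianSqVar * v ^ 2 := by
  rw [integral_comp_of_map_gaussianReal hX h (f := fun x => (x ^ 2 - v) ^ 2) (by fun_prop),
    gaussianSqVar, ← integral_mul_const]
  congr 1; ext x
  rw [mul_pow, Real.sq_sqrt v.coe_nonneg]
  ring

lemma integral_pow_four_of_map_gaussianReal {X : Ω → ℝ} {v : NNReal} (hX : Measurable X)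
    (h : P.map X = gaussianReal 0 v) : ∫ ω, X ω ^ 4 ∂P = gaussianFourth * v ^ 2 := by
  rw [integral_comp_of_map_gaussianReal hX h (f := fun x => x ^ 4) (by fun_prop),
    gaussianFourth, ← integral_mul_const]
  congr 1; ext x
  rw [mul_pow, show Real.sqrt v ^ 4 = (Real.sqrt v ^ 2) ^ 2 by ring, Real.sq_sqrt v.coe_nonneg]
  ring

lemma integral_sq_of_map_gaussianReal {X : Ω → ℝ} {v : NNReal} (hX : Measurable X)
    (h : P.map X = gaussianReal 0 v) : ∫ ω, X ω ^ 2 ∂P = v := by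
  rw [← variance_eq_of_map_gaussianReal hX h, variance_of_integral_eq_zero hX.aemeasurable
    (integral_eq_zero_of_map_gaussianReal hX h)]

lemma integrable_pow_of_map_gaussianReal {X : Ω → ℝ} {v : NNReal} (hX : Measurable X)
    (h : P.map X = gaussianReal 0 v) (k : ℕ) : Integrable (fun ω => X ω ^ k) P := by
  have hf : IsFiniteMeasure P := ⟨by
    have : P.map X univ = 1 := by rw [h]; simp
    rw [Measure.map_apply hX MeasurableSet.univ] at this
    simp_all⟩
  simpa using (memLp_of_map_gaussianReal hX h k).integrable_norm_pow'.congr'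
    (hX.pow_const k).aestronglyMeasurable (by simp)

lemma memLp_sq_sub_of_map_gaussianReal [IsProbabilityMeasure P] {X : Ω → ℝ} {v : NNReal}
    (hX : Measurable X) (h : P.map X = gaussianReal 0 v) :
    MemLp (fun ω => X ω ^ 2 - v) 2 P := by
  rw [memLp_two_iff_integrable_sq (by fun_prop)]
  have e : (fun ω => (X ω ^ 2 - v) ^ 2) = fun ω => X ω ^ 4 - 2 * v * X ω ^ 2 + (v : ℝ) ^ 2 := by
    ext ω; ring
  rw [e]
  exact ((integrable_pow_of_map_gaussianReal hX h 4).sub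
    ((integrable_pow_of_map_gaussianReal hX h 2).const_mul _)).add (integrable_const _)

lemma integral_sum_sq_le [IsProbabilityMeasure P] {φ ξ : ℕ → Ω → ℝ} {v : ℕ → NNReal} {K : ℝ}
    (hφ : ∀ i, Measurable (φ i)) (hξ : ∀ i, Measurable (ξ i)) (hK : ∀ i ω, |φ i ω| ≤ K) (N : ℕ)
    (hind : ∀ i < N,
      IndepFun (fun ω => (∑ j ∈ Finset.range i, φ j ω * (ξ j ω ^ 2 - v j), φ i ω)) (ξ i) P)
    (h : ∀ i < N, P.map (ξ i) = gaussianReal 0 (v i)) :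
    MemLp (fun ω => ∑ i ∈ Finset.range N, φ i ω * (ξ i ω ^ 2 - v i)) 2 P ∧
    ∫ ω, (∑ i ∈ Finset.range N, φ i ω * (ξ i ω ^ 2 - v i)) ^ 2 ∂P ≤
      K ^ 2 * gaussianSqVar * ∑ i ∈ Finset.range N, (v i : ℝ) ^ 2 := by
  induction N with
  | zero => simp
  | succ n ih =>
    obtain ⟨hM, hle⟩ := ih (fun i hi => hind i (by omega)) (fun i hi => h i (by omega))
    have hn := h n (by omega)
    set M : Ω → ℝ := fun ω => ∑ i ∈ Finset.range n, φ i ω * (ξ i ω ^ 2 - v i) with hMdef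
    have hMm : Measurable M := by fun_prop
    set ζ : Ω → ℝ := fun ω => ξ n ω ^ 2 - v n with hζdef
    have hζm : Measurable ζ := by fun_prop
    have hζ : MemLp ζ 2 P := memLp_sq_sub_of_map_gaussianReal (hξ n) hn
    have hφζ : MemLp (fun ω => φ n ω * ζ ω) 2 P := by
      refine (hζ.const_mul K).of_le (by fun_prop) (ae_of_all _ fun ω => ?_)
      rw [norm_mul, norm_mul]
      gcongr
      exact (hK n ω).trans (le_abs_self K)
    have hζ0 : ∫ ω, ζ ω ∂P = 0 := by
      rw [hζdef, integral_sub (integrable_pow_of_map_gaussianReal (hξ n) hn 2)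
        (integrable_const _), integral_sq_of_map_gaussianReal (hξ n) hn]
      simp
    have hcross : ∫ ω, M ω * φ n ω * ζ ω ∂P = 0 := by
      have hi : IndepFun (fun ω => M ω * φ n ω) ζ P :=
        (hind n (by omega)).comp (φ := fun z : ℝ × ℝ => z.1 * z.2)
          (ψ := fun x => x ^ 2 - (v n : ℝ)) (by fun_prop) (by fun_prop)
      rw [hi.integral_fun_mul_eq_mul_integral (by fun_prop) (by fun_prop), hζ0, mul_zero]
    have i1 : Integrable (fun ω => M ω ^ 2) P := hM.integrable_sq
    have i2 : Integrable (fun ω => (φ n ω * ζ ω) ^ 2) P := hφζ.integrable_sq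
    have i3 : Integrable (fun ω => M ω * φ n ω * ζ ω) P := by
      have := hM.integrable_mul hφζ
      refine this.congr (ae_of_all _ fun ω => ?_)
      simp [mul_assoc]
    refine ⟨?_, ?_⟩
    · simp_rw [Finset.sum_range_succ]
      exact hM.add hφζ
    · have e : (fun ω => (∑ i ∈ Finset.range (n + 1), φ i ω * (ξ i ω ^ 2 - v i)) ^ 2) =
          fun ω => (M ω ^ 2 + 2 * (M ω * φ n ω * ζ ω)) + (φ n ω * ζ ω) ^ 2 := by
        ext ω
        rw [Finset.sum_range_succ, hMdef, hζdef]
        ring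
      have hb : ∫ ω, (φ n ω * ζ ω) ^ 2 ∂P ≤ K ^ 2 * gaussianSqVar * (v n : ℝ) ^ 2 := by
        rw [mul_assoc, ← integral_sq_sub_sq_of_map_gaussianReal (hξ n) hn, ← integral_const_mul]
        refine integral_mono i2 (hζ.integrable_sq.const_mul _) fun ω => ?_
        simp only [mul_pow]
        exact mul_le_mul_of_nonneg_right
          (sq_le_sq' (abs_le.1 (hK n ω)).1 (abs_le.1 (hK n ω)).2) (sq_nonneg _)
      have i4 : Integrable (fun ω => M ω ^ 2 + 2 * (M ω * φ n ω * ζ ω)) P :=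
        i1.add (i3.const_mul 2)
      rw [e, integral_add i4 i2, integral_add i1 (i3.const_mul 2),
        integral_const_mul, hcross, Finset.sum_range_succ, mul_add]
      linarith

lemma ProbabilityTheory.IsGaussianProcess.indepFun_sub_mul [IsProbabilityMeasure P] {T S : Type*} {X : T → Ω → ℝ}
    (hX : IsGaussianProcess X P) (hm : ∀ t, Measurable (X t)) (z : S → T) (t u : T) (γ : ℝ)
    (h : ∀ σ, cov[X (z σ), X t; P] = γ * cov[X (z σ), X u; P]) :
    IndepFun (fun ω σ => X (z σ) ω) (fun ω => X t ω - γ * X u ω) P := by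
  classical
  have hL (t : T) : MemLp (X t) 2 P := (hX.hasGaussianLaw_eval t).memLp_two
  have hg : IsGaussianProcess (Sum.elim (fun σ => X (z σ))
      (fun (_ : Unit) ω => X t ω - γ * X u ω)) P := by
    refine hX.of_isGaussianProcess fun s => ?_
    rcases s with σ | _
    · exact ⟨{z σ}, ContinuousLinearMap.proj ⟨z σ, by simp⟩, fun ω => rfl⟩
    · exact ⟨{t, u}, ContinuousLinearMap.proj ⟨t, by simp⟩ -
        γ • ContinuousLinearMap.proj ⟨u, by simp⟩, fun ω => rfl⟩
  have := hg.indepFun_of_covariance_eq_zero (fun σ => (hm _).aemeasurable)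
    (fun _ => ((hm t).sub ((hm u).const_mul γ)).aemeasurable) fun σ _ => by
      have := covariance_fun_sub_right (hL (z σ)) (hL t) ((hL u).const_mul γ)
      rw [this, covariance_const_mul_right, h]
      simp
  exact this.comp (φ := id) (ψ := fun f : Unit → ℝ => f ()) measurable_id (measurable_pi_apply ())

lemma ProbabilityTheory.IsGaussianProcess.map_sub_mul [IsProbabilityMeasure P] {T : Type*} {X : T → Ω → ℝ}
    (hX : IsGaussianProcess X P) (hm : ∀ t, Measurable (X t)) (h0 : ∀ t, ∫ ω, X t ω ∂P = 0)
    (t u : T) (γ : ℝ) :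
    P.map (fun ω => X t ω - γ * X u ω) = gaussianReal 0
      (cov[X t, X t; P] - 2 * γ * cov[X t, X u; P] + γ ^ 2 * cov[X u, X u; P]).toNNReal := by
  classical
  have hL (t : T) : MemLp (X t) 2 P := (hX.hasGaussianLaw_eval t).memLp_two
  have hg : HasGaussianLaw (fun ω => X t ω - γ * X u ω) P := by
    have := (hX.hasGaussianLaw_prodMk (s := t) (t := u)).map
      (ContinuousLinearMap.fst ℝ ℝ ℝ - γ • ContinuousLinearMap.snd ℝ ℝ ℝ)
    exact this
  rw [hg.map_eq_gaussianReal]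
  congr 1
  · rw [integral_sub ((hL t).integrable (by norm_num))
      (((hL u).const_mul γ).integrable (by norm_num)), integral_const_mul, h0, h0]
    simp
  · congr 1
    rw [variance_fun_sub (hL t) ((hL u).const_mul γ), covariance_const_mul_right,
      variance_const_mul, covariance_self (hm t).aemeasurable, covariance_self (hm u).aemeasurable]
    ring

end GaussianTools

/-- `X (i, c)` is the `c`-th coordinate at time `τ i` of a `d`-dimensional Brownian motion with
variance parameter `s`. -/
structure IsSampledBM {Ω : Type*} [MeasurableSpace Ω] (P : Measure Ω) {d : ℕ} (s : ℝ) (τ : ℕ → ℝ)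
    (X : ℕ × Fin d → Ω → ℝ) : Prop where
  gaussian : IsGaussianProcess X P
  measurable : ∀ q, Measurable (X q)
  mean : ∀ q, ∫ ω, X q ω ∂P = 0
  cov : ∀ q r, cov[X q, X r; P] = if q.2 = r.2 then s * min (τ q.1) (τ r.1) else 0
  pos : 0 < s
  mono : Monotone τ
  nonneg : ∀ i, 0 ≤ τ i

/-- The point of a path at time `i`. -/
def pathPt {d : ℕ} (i : ℕ) (p : ℕ × Fin d → ℝ) : EuclideanSpace ℝ (Fin d) :=
  WithLp.toLp 2 fun c => p (i, c)

/-- The point of a path at time `i`, with the `c`-th coordinate taken at time `i + 1`. -/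
def mixPt {d : ℕ} (c : Fin d) (i : ℕ) (p : ℕ × Fin d → ℝ) : EuclideanSpace ℝ (Fin d) :=
  WithLp.toLp 2 fun c' => if c' = c then p (i + 1, c) else p (i, c')

@[fun_prop]
lemma measurable_pathPt {d : ℕ} (i : ℕ) : Measurable (pathPt (d := d) i) := by
  unfold pathPt; fun_prop

@[fun_prop]
lemma measurable_mixPt {d : ℕ} (c : Fin d) (i : ℕ) : Measurable (mixPt c i) := by
  refine (WithLp.measurable_toLp 2 _).comp (measurable_pi_lambda _ fun c' => ?_)
  by_cases h : c' = c <;> simp only [h, if_true, if_false] <;> fun_prop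

/-- Index map stopping the `c`-th coordinate at time `m`. -/
def pastIdx {d : ℕ} (c : Fin d) (m : ℕ) (q : ℕ × Fin d) : ℕ × Fin d :=
  if q.2 = c then (min q.1 m, c) else q

/-- Index map starting the `c`-th coordinate at time `m`. -/
def futureIdx {d : ℕ} (c : Fin d) (m : ℕ) (q : ℕ × Fin d) : ℕ × Fin d :=
  if q.2 = c then (max q.1 m, c) else q

lemma pathPt_comp_pastIdx {d : ℕ} (c : Fin d) {i m : ℕ} (h : i ≤ m) (p : ℕ × Fin d → ℝ) :
    pathPt i (p ∘ pastIdx c m) = pathPt i p := by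
  ext c'
  by_cases hc : c' = c <;> simp [pathPt, pastIdx, hc, h]

lemma apply_pastIdx {d : ℕ} (c : Fin d) {i m : ℕ} (h : i ≤ m) :
    pastIdx c m (i, c) = (i, c) := by
  simp [pastIdx, h]

lemma mixPt_comp_futureIdx {d : ℕ} (c : Fin d) {i m : ℕ} (h : m ≤ i + 1) (p : ℕ × Fin d → ℝ) :
    mixPt c i (p ∘ futureIdx c m) = mixPt c i p := by
  ext c'
  by_cases hc : c' = c <;> simp [mixPt, futureIdx, hc, h]

lemma apply_futureIdx {d : ℕ} (c : Fin d) {i m : ℕ} (h : m ≤ i) :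
    futureIdx c m (i, c) = (i, c) := by
  simp [futureIdx, h]

lemma exp_sum_mul_le_sum {N : ℕ} {w y : ℕ → ℝ} (hw : ∀ i ∈ Finset.range N, 0 ≤ w i)
    (h0 : 0 < ∑ i ∈ Finset.range N, w i) :
    Real.exp (∑ i ∈ Finset.range N, w i * y i) ≤ ∑ i ∈ Finset.range N,
      (w i / ∑ j ∈ Finset.range N, w j) * Real.exp ((∑ j ∈ Finset.range N, w j) * y i) := by
  set S := ∑ i ∈ Finset.range N, w i with hS
  have := convexOn_exp.map_sum_le (t := Finset.range N) (w := fun i => w i / S)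
    (p := fun i => S * y i) (fun i hi => div_nonneg (hw i hi) h0.le)
    (by rw [← Finset.sum_div, div_self h0.ne']) (by simp)
  simp only [smul_eq_mul] at this
  refine le_trans (le_of_eq ?_) this
  congr 1
  refine Finset.sum_congr rfl fun i _ => ?_
  field_simp

lemma exp_sum_mul_le {N : ℕ} {w y : ℕ → ℝ} {A : ℝ} (hw : ∀ i ∈ Finset.range N, 0 ≤ w i)
    (hy : ∀ i, 0 ≤ y i) (h0 : 0 < ∑ i ∈ Finset.range N, w i)
    (hA : ∑ i ∈ Finset.range N, w i ≤ A) :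
    Real.exp (∑ i ∈ Finset.range N, w i * y i) ≤
      ∑ i ∈ Finset.range N, (w i / ∑ j ∈ Finset.range N, w j) * Real.exp (A * y i) := by
  refine (exp_sum_mul_le_sum hw h0).trans (Finset.sum_le_sum fun i hi => ?_)
  refine mul_le_mul_of_nonneg_left ?_ (div_nonneg (hw i hi) h0.le)
  exact Real.exp_le_exp.2 (mul_le_mul_of_nonneg_right hA (hy i))

lemma sum_sub_div_sqrt_le {τ : ℕ → ℝ} (hm : Monotone τ) (h0 : ∀ i, 0 ≤ τ i) (N : ℕ) :
    ∑ i ∈ Finset.range N, (τ (i + 1) - τ i) / Real.sqrt (τ (i + 1)) ≤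
      2 * Real.sqrt (τ N - τ 0) := by
  have h1 : ∑ i ∈ Finset.range N, (τ (i + 1) - τ i) / Real.sqrt (τ (i + 1)) ≤
      ∑ i ∈ Finset.range N, 2 * (Real.sqrt (τ (i + 1)) - Real.sqrt (τ i)) := by
    refine Finset.sum_le_sum fun i _ => ?_
    have hle := hm (Nat.le_succ i)
    have hsq := Real.sqrt_le_sqrt hle
    rcases (Real.sqrt_nonneg (τ (i + 1))).eq_or_lt with h | h
    · simp only [Nat.succ_eq_add_one] at hsq
      rw [← h] at hsq ⊢
      have := Real.sqrt_nonneg (τ i)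
      simp; linarith
    · rw [div_le_iff₀ h]
      have e1 := Real.mul_self_sqrt (h0 (i + 1))
      have e2 := Real.mul_self_sqrt (h0 i)
      nlinarith [sq_nonneg (Real.sqrt (τ (i + 1)) - Real.sqrt (τ i))]
  rw [← Finset.mul_sum, Finset.sum_range_sub (fun i => Real.sqrt (τ i))] at h1
  refine h1.trans ?_
  have : Real.sqrt (τ N) ≤ Real.sqrt (τ N - τ 0) + Real.sqrt (τ 0) := by
    have h := hm (Nat.zero_le N)
    rw [Real.sqrt_le_left (by positivity), add_sq, Real.sq_sqrt (by linarith),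
      Real.sq_sqrt (h0 0)]
    have := Real.sqrt_nonneg (τ N - τ 0)
    have := Real.sqrt_nonneg (τ 0)
    nlinarith [mul_nonneg (Real.sqrt_nonneg (τ N - τ 0)) (Real.sqrt_nonneg (τ 0))]
  linarith

namespace IsSampledBM

variable {Ω : Type*} [MeasurableSpace Ω] {P : Measure Ω} [IsProbabilityMeasure P] {d : ℕ} {s : ℝ}
  {τ : ℕ → ℝ} {X : ℕ × Fin d → Ω → ℝ}

omit [IsProbabilityMeasure P] in
lemma measurable_path (hX : IsSampledBM P s τ X) : Measurable fun ω q => X q ω :=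
  measurable_pi_lambda _ fun q => hX.measurable q

lemma map_eval (hX : IsSampledBM P s τ X) (i : ℕ) (c : Fin d) :
    P.map (X (i, c)) = gaussianReal 0 (s * τ i).toNNReal := by
  have := hX.gaussian.map_sub_mul hX.measurable hX.mean (i, c) (i, c) 0
  simpa [hX.cov] using this

lemma map_increment (hX : IsSampledBM P s τ X) (i : ℕ) (c : Fin d) :
    P.map (fun ω => X (i + 1, c) ω - X (i, c) ω) =
      gaussianReal 0 (s * (τ (i + 1) - τ i)).toNNReal := by
  have := hX.gaussian.map_sub_mul hX.measurable hX.mean (i + 1, c) (i, c) 1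
  simp only [one_mul] at this
  rw [this]
  congr 2
  simp only [hX.cov, if_true, min_self, min_eq_right (hX.mono (Nat.le_succ i))]
  ring

lemma map_bridge (hX : IsSampledBM P s τ X) (i : ℕ) (c : Fin d) :
    P.map (fun ω => X (i, c) ω - τ i / τ (i + 1) * X (i + 1, c) ω) =
      gaussianReal 0 (s * (τ i - τ i / τ (i + 1) * τ i)).toNNReal := by
  have := hX.gaussian.map_sub_mul hX.measurable hX.mean (i, c) (i + 1, c) (τ i / τ (i + 1))
  rw [this]
  congr 2
  simp only [hX.cov, if_true, min_self, min_eq_left (hX.mono (Nat.le_succ i))]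
  by_cases h : τ (i + 1) = 0
  · simp [h]
  · field_simp
    ring

omit [IsProbabilityMeasure P] in
lemma bridge_variance_le (hX : IsSampledBM P s τ X) (i : ℕ) :
    s * (τ i - τ i / τ (i + 1) * τ i) ≤ s * (τ (i + 1) - τ i) := by
  refine mul_le_mul_of_nonneg_left ?_ hX.pos.le
  have h1 := hX.mono (Nat.le_succ i)
  have h0 := hX.nonneg i
  simp only [Nat.succ_eq_add_one] at h1
  rcases (hX.nonneg (i + 1)).eq_or_lt with h | h
  · rw [← h] at h1 ⊢
    simp; linarith
  · have : τ i / τ (i + 1) * τ i = τ i ^ 2 / τ (i + 1) := by ring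
    rw [this, sub_le_iff_le_add, ← sub_le_iff_le_add', le_div_iff₀ h]
    nlinarith [sq_nonneg (τ (i + 1) - τ i)]

lemma indepFun_past (hX : IsSampledBM P s τ X) (c : Fin d) (i : ℕ) {E : Type*} [MeasurableSpace E]
    {A : (ℕ × Fin d → ℝ) → E} (hA : Measurable A) (h : ∀ p, A (p ∘ pastIdx c i) = A p) :
    IndepFun (fun ω => A fun q => X q ω) (fun ω => X (i + 1, c) ω - X (i, c) ω) P := by
  have := hX.gaussian.indepFun_sub_mul hX.measurable (pastIdx c i) (i + 1, c) (i, c) 1 fun σ => by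
    simp only [hX.cov, one_mul, pastIdx]
    split_ifs with h1 h2
    · rw [min_eq_left (hX.mono ((min_le_right _ _).trans (Nat.le_succ i))),
        min_eq_left (hX.mono (min_le_right _ _))]
    all_goals simp_all
  simp only [one_mul] at this
  have := this.comp hA measurable_id
  refine this.congr (ae_of_all _ fun ω => ?_) (ae_of_all _ fun ω => rfl)
  exact h fun q => X q ω

lemma indepFun_future (hX : IsSampledBM P s τ X) (c : Fin d) (i : ℕ) {E : Type*}
    [MeasurableSpace E] {A : (ℕ × Fin d → ℝ) → E} (hA : Measurable A)
    (h : ∀ p, A (p ∘ futureIdx c (i + 1)) = A p) :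
    IndepFun (fun ω => A fun q => X q ω)
      (fun ω => X (i, c) ω - τ i / τ (i + 1) * X (i + 1, c) ω) P := by
  have := hX.gaussian.indepFun_sub_mul hX.measurable (futureIdx c (i + 1)) (i, c) (i + 1, c)
    (τ i / τ (i + 1)) fun σ => by
      simp only [hX.cov, futureIdx]
      split_ifs with h1 h2
      · have h3 := hX.mono (Nat.le_succ i)
        rw [min_eq_right (hX.mono (le_max_right σ.1 (i + 1))),
          min_eq_right (h3.trans (hX.mono (le_max_right σ.1 (i + 1))))]
        rcases (hX.nonneg (i + 1)).eq_or_lt with h | h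
        · have h4 : τ i = 0 := le_antisymm (h3.trans h.symm.le) (hX.nonneg i)
          simp [h4]
        · field_simp
      all_goals simp_all
  have := this.comp hA measurable_id
  refine this.congr (ae_of_all _ fun ω => ?_) (ae_of_all _ fun ω => rfl)
  exact h fun q => X q ω

variable {F : ℕ → EuclideanSpace ℝ (Fin d) → ℝ} {K : ℝ}

lemma lintegral_exp_forward_le (hX : IsSampledBM P s τ X) (c : Fin d)
    (hF : ∀ i, Measurable (F i)) (hK : ∀ i x, |F i x| ≤ K) (N : ℕ) (θ : ℝ) :
    ∫⁻ ω, ENNReal.ofReal (Real.exp (θ * ∑ i ∈ Finset.range N,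
      F i (pathPt i fun q => X q ω) * (X (i + 1, c) ω - X (i, c) ω))) ∂P ≤
      ENNReal.ofReal (Real.exp (θ ^ 2 * K ^ 2 * (s * (τ N - τ 0)) / 2)) := by
  have hXm := hX.measurable
  have hp := hX.measurable_path
  have := lintegral_exp_sum_le (P := P) (φ := fun i ω => F i (pathPt i fun q => X q ω))
    (ξ := fun i ω => X (i + 1, c) ω - X (i, c) ω)
    (v := fun i => (s * (τ (i + 1) - τ i)).toNNReal) (K := K) (fun i => by fun_prop)
    (fun i => by fun_prop) (fun i ω => hK _ _) N (fun i _ => ?_)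
    (fun i _ => hX.map_increment i c) θ
  · refine this.trans (le_of_eq ?_)
    congr 5
    rw [← Finset.sum_range_sub, Finset.mul_sum]
    refine Finset.sum_congr rfl fun i _ => Real.coe_toNNReal _ ?_
    exact mul_nonneg hX.pos.le (sub_nonneg.2 (hX.mono (Nat.le_succ i)))
  · refine hX.indepFun_past c i (A := fun p => (∑ j ∈ Finset.range i, F j (pathPt j p) *
      (p (j + 1, c) - p (j, c)), F i (pathPt i p))) (by fun_prop) fun p => ?_
    refine Prod.ext ?_ ?_
    · dsimp only
      refine Finset.sum_congr rfl fun j hj => ?_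
      have hj' := Finset.mem_range.1 hj
      simp only [Function.comp_apply]
      rw [pathPt_comp_pastIdx c hj'.le, apply_pastIdx c hj'.le, apply_pastIdx c hj']
    · simp only
      rw [pathPt_comp_pastIdx c le_rfl]

lemma integral_sum_sq_forward_le (hX : IsSampledBM P s τ X) (c : Fin d)
    (hF : ∀ i, Measurable (F i)) (hK : ∀ i x, |F i x| ≤ K) (N : ℕ) :
    MemLp (fun ω => ∑ i ∈ Finset.range N, F i (pathPt i fun q => X q ω) *
      ((X (i + 1, c) ω - X (i, c) ω) ^ 2 - s * (τ (i + 1) - τ i))) 2 P ∧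
    ∫ ω, (∑ i ∈ Finset.range N, F i (pathPt i fun q => X q ω) *
      ((X (i + 1, c) ω - X (i, c) ω) ^ 2 - s * (τ (i + 1) - τ i))) ^ 2 ∂P ≤
      K ^ 2 * gaussianSqVar * ∑ i ∈ Finset.range N, (s * (τ (i + 1) - τ i)) ^ 2 := by
  have hXm := hX.measurable
  have hp := hX.measurable_path
  have hv (i : ℕ) : ((s * (τ (i + 1) - τ i)).toNNReal : ℝ) = s * (τ (i + 1) - τ i) :=
    Real.coe_toNNReal _ (mul_nonneg hX.pos.le (sub_nonneg.2 (hX.mono (Nat.le_succ i))))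
  have := integral_sum_sq_le (P := P) (φ := fun i ω => F i (pathPt i fun q => X q ω))
    (ξ := fun i ω => X (i + 1, c) ω - X (i, c) ω)
    (v := fun i => (s * (τ (i + 1) - τ i)).toNNReal) (K := K) (fun i => by fun_prop)
    (fun i => by fun_prop) (fun i ω => hK _ _) N (fun i _ => ?_)
    (fun i _ => hX.map_increment i c)
  · simpa only [hv] using this
  · refine hX.indepFun_past c i (A := fun p => (∑ j ∈ Finset.range i, F j (pathPt j p) *
      ((p (j + 1, c) - p (j, c)) ^ 2 - ((s * (τ (j + 1) - τ j)).toNNReal : ℝ)),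
      F i (pathPt i p))) (by fun_prop) fun p => ?_
    refine Prod.ext ?_ ?_
    · dsimp only
      refine Finset.sum_congr rfl fun j hj => ?_
      have hj' := Finset.mem_range.1 hj
      simp only [Function.comp_apply]
      rw [pathPt_comp_pastIdx c hj'.le, apply_pastIdx c hj'.le, apply_pastIdx c hj']
    · simp only
      rw [pathPt_comp_pastIdx c le_rfl]

lemma lintegral_exp_backward_le (hX : IsSampledBM P s τ X) (c : Fin d)
    (hF : ∀ i, Measurable (F i)) (hK : ∀ i x, |F i x| ≤ K) (N : ℕ) (θ : ℝ) :
    ∫⁻ ω, ENNReal.ofReal (Real.exp (θ * ∑ i ∈ Finset.range N,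
      F i (mixPt c i fun q => X q ω) * (X (i, c) ω - τ i / τ (i + 1) * X (i + 1, c) ω))) ∂P ≤
      ENNReal.ofReal (Real.exp (θ ^ 2 * K ^ 2 * (s * (τ N - τ 0)) / 2)) := by
  have hXm := hX.measurable
  have hp := hX.measurable_path
  have := lintegral_exp_sum_le (P := P)
    (φ := fun k ω => F (N - 1 - k) (mixPt c (N - 1 - k) fun q => X q ω))
    (ξ := fun k ω => X (N - 1 - k, c) ω -
      τ (N - 1 - k) / τ (N - 1 - k + 1) * X (N - 1 - k + 1, c) ω)
    (v := fun k => (s * (τ (N - 1 - k) - τ (N - 1 - k) / τ (N - 1 - k + 1) *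
      τ (N - 1 - k))).toNNReal) (K := K) (fun i => by fun_prop)
    (fun i => by fun_prop) (fun i ω => hK _ _) N (fun k hk => ?_)
    (fun k _ => hX.map_bridge (N - 1 - k) c) θ
  · have e (ω : Ω) := Finset.sum_range_reflect (fun i => F i (mixPt c i fun q => X q ω) *
      (X (i, c) ω - τ i / τ (i + 1) * X (i + 1, c) ω)) N
    simp only [e] at this
    rw [Finset.sum_range_reflect
      (fun i => ((s * (τ i - τ i / τ (i + 1) * τ i)).toNNReal : ℝ)) N] at this
    refine this.trans (ENNReal.ofReal_le_ofReal (Real.exp_le_exp.2 ?_))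
    gcongr
    rw [← Finset.sum_range_sub, Finset.mul_sum]
    refine Finset.sum_le_sum fun i _ => ?_
    rw [Real.coe_toNNReal']
    refine max_le (hX.bridge_variance_le i) ?_
    exact mul_nonneg hX.pos.le (sub_nonneg.2 (hX.mono (Nat.le_succ i)))
  · refine hX.indepFun_future c (N - 1 - k) (A := fun p => (∑ j ∈ Finset.range k,
      F (N - 1 - j) (mixPt c (N - 1 - j) p) * (p (N - 1 - j, c) -
        τ (N - 1 - j) / τ (N - 1 - j + 1) * p (N - 1 - j + 1, c)),
      F (N - 1 - k) (mixPt c (N - 1 - k) p))) (by fun_prop) fun p => ?_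
    refine Prod.ext ?_ ?_
    · dsimp only
      refine Finset.sum_congr rfl fun j hj => ?_
      have hj' := Finset.mem_range.1 hj
      simp only [Function.comp_apply]
      rw [mixPt_comp_futureIdx c (by omega), apply_futureIdx c (by omega),
        apply_futureIdx c (by omega)]
    · simp only
      rw [mixPt_comp_futureIdx c (by omega)]

lemma lintegral_exp_drift_le (hX : IsSampledBM P s τ X) (c : Fin d) (N : ℕ) {θ : ℝ} (hθ : 0 ≤ θ) :
    ∫⁻ ω, ENNReal.ofReal (Real.exp (θ * ∑ i ∈ Finset.range N,
      (τ (i + 1) - τ i) / τ (i + 1) * |X (i + 1, c) ω|)) ∂P ≤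
      2 * ENNReal.ofReal (Real.exp (θ ^ 2 * (4 * (s * (τ N - τ 0))) / 2)) := by
  have hXm := hX.measurable
  set w : ℕ → ℝ := fun i => (τ (i + 1) - τ i) / Real.sqrt (τ (i + 1)) with hw
  have hw0 (i : ℕ) : 0 ≤ w i :=
    div_nonneg (sub_nonneg.2 (hX.mono (Nat.le_succ i))) (Real.sqrt_nonneg _)
  have hτ : 0 ≤ τ N - τ 0 := sub_nonneg.2 (hX.mono (Nat.zero_le N))
  have hs := hX.pos
  have e (i : ℕ) (ω : Ω) : (τ (i + 1) - τ i) / τ (i + 1) * |X (i + 1, c) ω| =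
      w i * ((Real.sqrt (τ (i + 1)))⁻¹ * |X (i + 1, c) ω|) := by
    rw [hw, ← mul_assoc]
    congr 1
    rw [div_mul_eq_mul_div, ← div_eq_mul_inv, div_div, Real.mul_self_sqrt (hX.nonneg _)]
  simp_rw [e]
  have hsum := sum_sub_div_sqrt_le hX.mono hX.nonneg N
  rcases (Finset.sum_nonneg fun i (_ : i ∈ Finset.range N) => hw0 i).eq_or_lt with h0 | h0
  · have hz := (Finset.sum_eq_zero_iff_of_nonneg fun i _ => hw0 i).1 h0.symm
    have : ∀ ω, ∑ i ∈ Finset.range N, w i * ((Real.sqrt (τ (i + 1)))⁻¹ * |X (i + 1, c) ω|) = 0 :=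
      fun ω => Finset.sum_eq_zero fun i hi => by rw [hz i hi, zero_mul]
    simp only [this, mul_zero, Real.exp_zero, ENNReal.ofReal_one, lintegral_const, measure_univ,
      mul_one]
    have h1 : (1 : ENNReal) ≤ ENNReal.ofReal (Real.exp (θ ^ 2 * (4 * (s * (τ N - τ 0))) / 2)) := by
      rw [← ENNReal.ofReal_one]
      exact ENNReal.ofReal_le_ofReal (Real.one_le_exp (by positivity))
    exact le_trans h1 (le_mul_of_one_le_left (zero_le) (by norm_num))
  · set S := ∑ i ∈ Finset.range N, w i with hS
    have hb (i : ℕ) : ∫⁻ ω, ENNReal.ofReal (Real.exp (2 * Real.sqrt (τ N - τ 0) *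
        (θ * ((Real.sqrt (τ (i + 1)))⁻¹ * |X (i + 1, c) ω|)))) ∂P ≤
        2 * ENNReal.ofReal (Real.exp (θ ^ 2 * (4 * (s * (τ N - τ 0))) / 2)) := by
      have := lintegral_exp_mul_abs_le (P := P) (hXm (i + 1, c)) (hX.map_eval (i + 1) c)
        (2 * Real.sqrt (τ N - τ 0) * (θ * (Real.sqrt (τ (i + 1)))⁻¹))
      have e2 (ω : Ω) : 2 * Real.sqrt (τ N - τ 0) *
          (θ * ((Real.sqrt (τ (i + 1)))⁻¹ * |X (i + 1, c) ω|)) =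
          2 * Real.sqrt (τ N - τ 0) * (θ * (Real.sqrt (τ (i + 1)))⁻¹) * |X (i + 1, c) ω| := by ring
      simp_rw [e2]
      refine this.trans ?_
      refine mul_le_mul_right (ENNReal.ofReal_le_ofReal (Real.exp_le_exp.2 ?_)) _
      rw [Real.coe_toNNReal _ (mul_nonneg hs.le (hX.nonneg _)), mul_pow, mul_pow, mul_pow,
        Real.sq_sqrt hτ, inv_pow, Real.sq_sqrt (hX.nonneg _)]
      rcases (hX.nonneg (i + 1)).eq_or_lt with h | h
      · rw [← h]; simp; positivity
      · refine le_of_eq ?_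
        field_simp
        norm_num
        ring
    calc _ ≤ ∫⁻ ω, ∑ i ∈ Finset.range N, ENNReal.ofReal (w i / S) *
          ENNReal.ofReal (Real.exp (2 * Real.sqrt (τ N - τ 0) *
            (θ * ((Real.sqrt (τ (i + 1)))⁻¹ * |X (i + 1, c) ω|)))) ∂P := by
          refine lintegral_mono fun ω => ?_
          have := exp_sum_mul_le (N := N) (w := w) (A := 2 * Real.sqrt (τ N - τ 0))
            (y := fun i => θ * ((Real.sqrt (τ (i + 1)))⁻¹ * |X (i + 1, c) ω|))
            (fun i _ => hw0 i) (fun i => by positivity) h0 hsum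
          simp_rw [← ENNReal.ofReal_mul (div_nonneg (hw0 _) h0.le)]
          rw [← ENNReal.ofReal_sum_of_nonneg
            fun i _ => mul_nonneg (div_nonneg (hw0 _) h0.le) (Real.exp_pos _).le]
          refine ENNReal.ofReal_le_ofReal (le_trans (le_of_eq ?_) this)
          rw [Finset.mul_sum]
          congr 1
          exact Finset.sum_congr rfl fun i _ => by ring
      _ = ∑ i ∈ Finset.range N, ENNReal.ofReal (w i / S) *
          ∫⁻ ω, ENNReal.ofReal (Real.exp (2 * Real.sqrt (τ N - τ 0) *
            (θ * ((Real.sqrt (τ (i + 1)))⁻¹ * |X (i + 1, c) ω|)))) ∂P := by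
          rw [lintegral_finsetSum _ fun i _ => by fun_prop]
          exact Finset.sum_congr rfl fun i _ => lintegral_const_mul _ (by fun_prop)
      _ ≤ ∑ i ∈ Finset.range N, ENNReal.ofReal (w i / S) *
          (2 * ENNReal.ofReal (Real.exp (θ ^ 2 * (4 * (s * (τ N - τ 0))) / 2))) := by
          gcongr with i hi
          exact hb i
      _ = _ := by
          rw [← Finset.sum_mul, ← ENNReal.ofReal_sum_of_nonneg
            fun i _ => div_nonneg (hw0 _) h0.le, ← Finset.sum_div, div_self h0.ne']
          simp

/-- Sub-Gaussian bound for the discrete quadratic covariation. -/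
lemma lintegral_exp_covariation_le (hX : IsSampledBM P s τ X) (c : Fin d)
    (hF : ∀ i, Measurable (F i)) (hK : ∀ i x, |F i x| ≤ K) (N : ℕ) (θ : ℝ) :
    ∫⁻ ω, ENNReal.ofReal (Real.exp (θ * ∑ i ∈ Finset.range N,
      (F i (mixPt c i fun q => X q ω) - F i (pathPt i fun q => X q ω)) *
        (X (i + 1, c) ω - X (i, c) ω))) ∂P ≤
      2 * ENNReal.ofReal (Real.exp (18 * (θ ^ 2 * K ^ 2 * (s * (τ N - τ 0))))) := by
  have hXm := hX.measurable
  have hp := hX.measurable_path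
  have hK0 : 0 ≤ K := (abs_nonneg _).trans (hK 0 0)
  have hτ : 0 ≤ s * (τ N - τ 0) := mul_nonneg hX.pos.le (sub_nonneg.2 (hX.mono (Nat.zero_le N)))
  set A : Ω → ℝ := fun ω => ∑ i ∈ Finset.range N,
      F i (pathPt i fun q => X q ω) * (X (i + 1, c) ω - X (i, c) ω) with hA
  set B : Ω → ℝ := fun ω => ∑ i ∈ Finset.range N,
      F i (mixPt c i fun q => X q ω) * (X (i, c) ω - τ i / τ (i + 1) * X (i + 1, c) ω) with hB
  set D : Ω → ℝ := fun ω => ∑ i ∈ Finset.range N,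
      (τ (i + 1) - τ i) / τ (i + 1) * |X (i + 1, c) ω| with hD
  have mA : Measurable A := by fun_prop
  have mB : Measurable B := by fun_prop
  have mD : Measurable D := by fun_prop
  have hzero (i : ℕ) : ∀ᵐ ω ∂P, τ (i + 1) = 0 → X (i + 1, c) ω = 0 := by
    by_cases h : τ (i + 1) = 0
    · have h1 := hX.map_eval (i + 1) c
      rw [h, mul_zero, Real.toNNReal_zero, gaussianReal_zero_var] at h1
      have h2 : ∀ᵐ x ∂(P.map (X (i + 1, c))), x = 0 := by
        rw [h1]; simp
      filter_upwards [ae_of_ae_map (hXm _).aemeasurable h2] with ω hω _ using hω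
    · simp [h]
  have hpt : ∀ᵐ ω ∂P, θ * ∑ i ∈ Finset.range N,
      (F i (mixPt c i fun q => X q ω) - F i (pathPt i fun q => X q ω)) *
        (X (i + 1, c) ω - X (i, c) ω) ≤ -θ * A ω + -θ * B ω + (|θ| * K) * D ω := by
    filter_upwards [ae_all_iff.2 hzero] with ω hω
    have e : ∑ i ∈ Finset.range N,
        (F i (mixPt c i fun q => X q ω) - F i (pathPt i fun q => X q ω)) *
          (X (i + 1, c) ω - X (i, c) ω) = -A ω - B ω + ∑ i ∈ Finset.range N,
          F i (mixPt c i fun q => X q ω) * ((τ (i + 1) - τ i) / τ (i + 1) * X (i + 1, c) ω) := by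
      rw [hA, hB, ← Finset.sum_neg_distrib, ← Finset.sum_sub_distrib, ← Finset.sum_add_distrib]
      refine Finset.sum_congr rfl fun i _ => ?_
      by_cases h : τ (i + 1) = 0
      · rw [hω i h, h]; ring
      · field_simp
        ring
    have hle : |∑ i ∈ Finset.range N, F i (mixPt c i fun q => X q ω) *
        ((τ (i + 1) - τ i) / τ (i + 1) * X (i + 1, c) ω)| ≤ K * D ω := by
      rw [hD, Finset.mul_sum]
      refine (Finset.abs_sum_le_sum_abs _ _).trans (Finset.sum_le_sum fun i _ => ?_)
      rw [abs_mul, abs_mul, abs_of_nonneg (div_nonneg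
        (sub_nonneg.2 (hX.mono (Nat.le_succ i))) (hX.nonneg _))]
      refine mul_le_mul_of_nonneg_right (hK _ _) (mul_nonneg (div_nonneg
        (sub_nonneg.2 (hX.mono (Nat.le_succ i))) (hX.nonneg _)) (abs_nonneg _))
    rw [e]
    have h1 := le_abs_self (θ * ∑ i ∈ Finset.range N, F i (mixPt c i fun q => X q ω) *
        ((τ (i + 1) - τ i) / τ (i + 1) * X (i + 1, c) ω))
    rw [abs_mul] at h1
    have h2 := mul_le_mul_of_nonneg_left hle (abs_nonneg θ)
    linarith
  have hconv (a b e : ℝ) : Real.exp (a + b + e) ≤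
      (1 / 3) * Real.exp (3 * a) + (1 / 3) * Real.exp (3 * b) + (1 / 3) * Real.exp (3 * e) := by
    have := convexOn_exp.map_sum_le (t := Finset.univ) (w := fun _ : Fin 3 => (1 / 3 : ℝ))
      (p := ![3 * a, 3 * b, 3 * e]) (by simp) (by simp) (by simp)
    simp only [Fin.sum_univ_three, smul_eq_mul, Matrix.cons_val] at this
    refine le_trans (le_of_eq ?_) this
    congr 1
    ring
  have bA := hX.lintegral_exp_forward_le c hF hK N (3 * -θ)
  have bB := hX.lintegral_exp_backward_le c hF hK N (3 * -θ)
  have bD := hX.lintegral_exp_drift_le c N (θ := 3 * (|θ| * K)) (by positivity)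
  set Y := ENNReal.ofReal (Real.exp (18 * (θ ^ 2 * K ^ 2 * (s * (τ N - τ 0))))) with hY
  have bA' : ∫⁻ ω, ENNReal.ofReal (Real.exp (3 * (-θ * A ω))) ∂P ≤ 2 * Y := by
    simp_rw [← mul_assoc (3 : ℝ)]
    refine bA.trans (le_trans ?_ (le_mul_of_one_le_left (zero_le) (by norm_num)))
    refine ENNReal.ofReal_le_ofReal (Real.exp_le_exp.2 ?_)
    have : 0 ≤ θ ^ 2 * K ^ 2 * (s * (τ N - τ 0)) := by positivity
    linarith
  have bB' : ∫⁻ ω, ENNReal.ofReal (Real.exp (3 * (-θ * B ω))) ∂P ≤ 2 * Y := by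
    simp_rw [← mul_assoc (3 : ℝ)]
    refine bB.trans (le_trans ?_ (le_mul_of_one_le_left (zero_le) (by norm_num)))
    refine ENNReal.ofReal_le_ofReal (Real.exp_le_exp.2 ?_)
    have : 0 ≤ θ ^ 2 * K ^ 2 * (s * (τ N - τ 0)) := by positivity
    linarith
  have bD' : ∫⁻ ω, ENNReal.ofReal (Real.exp (3 * (|θ| * K * D ω))) ∂P ≤ 2 * Y := by
    have e (ω : Ω) : 3 * (|θ| * K * D ω) = 3 * (|θ| * K) * D ω := by ring
    simp_rw [e]
    refine bD.trans (le_of_eq ?_)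
    rw [hY]
    congr 3
    rw [mul_pow, mul_pow, sq_abs]
    ring
  calc _ ≤ ∫⁻ ω, (ENNReal.ofReal (1 / 3) * ENNReal.ofReal (Real.exp (3 * (-θ * A ω))) +
        ENNReal.ofReal (1 / 3) * ENNReal.ofReal (Real.exp (3 * (-θ * B ω))) +
        ENNReal.ofReal (1 / 3) * ENNReal.ofReal (Real.exp (3 * (|θ| * K * D ω)))) ∂P := by
        refine lintegral_mono_ae ?_
        filter_upwards [hpt] with ω hω
        rw [← ENNReal.ofReal_mul (by norm_num), ← ENNReal.ofReal_mul (by norm_num),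
          ← ENNReal.ofReal_mul (by norm_num), ← ENNReal.ofReal_add (by positivity) (by positivity),
          ← ENNReal.ofReal_add (by positivity) (by positivity)]
        exact ENNReal.ofReal_le_ofReal ((Real.exp_le_exp.2 hω).trans (hconv _ _ _))
    _ ≤ ENNReal.ofReal (1 / 3) * (2 * Y) + ENNReal.ofReal (1 / 3) * (2 * Y) +
        ENNReal.ofReal (1 / 3) * (2 * Y) := by
        rw [lintegral_add_left (by fun_prop), lintegral_add_left (by fun_prop),
          lintegral_const_mul _ (by fun_prop), lintegral_const_mul _ (by fun_prop),
          lintegral_const_mul _ (by fun_prop)]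
        gcongr
    _ = 2 * Y := by
        rw [← add_mul, ← add_mul, ← ENNReal.ofReal_add (by norm_num) (by norm_num),
          ← ENNReal.ofReal_add (by norm_num) (by norm_num)]
        norm_num

end IsSampledBM

/-- Riemann sums of a continuous function converge to its integral. -/
lemma tendsto_riemannSum {h : ℝ → ℝ} (hc : Continuous h) {a b : ℝ} (hab : a ≤ b)
    (ξ : ℕ → ℕ → ℝ) (hξ : ∀ N i : ℕ, i < N →
      ξ N i ∈ Set.Icc (a + i * ((b - a) / N)) (a + (i + 1 : ℕ) * ((b - a) / N))) :
    Tendsto (fun N : ℕ => ∑ i ∈ Finset.range N, h (ξ N i) * ((b - a) / N)) atTop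
      (nhds (∫ t in a..b, h t)) := by
  have hu : UniformContinuousOn h (Set.Icc a b) :=
    isCompact_Icc.uniformContinuousOn_of_continuous hc.continuousOn
  rw [Metric.tendsto_atTop]
  intro ε hε
  have hε' : 0 < ε / (b - a + 1) := div_pos hε (by linarith)
  obtain ⟨η, hη, hu⟩ := Metric.uniformContinuousOn_iff.1 hu _ hε'
  obtain ⟨M, hM⟩ := exists_nat_gt ((b - a) / η)
  refine ⟨M + 1, fun N hN => ?_⟩
  have hN0 : (0 : ℝ) < N := by exact_mod_cast (by omega : 0 < N)
  have hMN : (M : ℝ) < N := by exact_mod_cast (by omega : M < N)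
  set δ := (b - a) / N with hδ
  have hδ0 : 0 ≤ δ := div_nonneg (by linarith) hN0.le
  have hNδ : N * δ = b - a := by rw [hδ]; field_simp
  have hδη : δ < η := by
    rw [hδ, div_lt_iff₀ hN0]
    have := (div_lt_iff₀ hη).1 (hM.trans hMN)
    linarith
  have hsplit : ∫ t in a..b, h t =
      ∑ i ∈ Finset.range N, ∫ t in (a + i * δ)..(a + (i + 1 : ℕ) * δ), h t := by
    rw [intervalIntegral.sum_integral_adjacent_intervals (a := fun i : ℕ => a + i * δ)
      fun k _ => hc.intervalIntegrable _ _]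
    simp only [Nat.cast_zero, zero_mul, add_zero, hNδ]
    congr 1; ring
  have hterm : ∀ i ∈ Finset.range N,
      |h (ξ N i) * δ - ∫ t in (a + i * δ)..(a + (i + 1 : ℕ) * δ), h t| ≤
        ε / (b - a + 1) * δ := by
    intro i hi
    have hi' := Finset.mem_range.1 hi
    have e : a + (i + 1 : ℕ) * δ - (a + i * δ) = δ := by push_cast; ring
    have hiN : ((i + 1 : ℕ) : ℝ) * δ ≤ N * δ :=
      mul_le_mul_of_nonneg_right (by exact_mod_cast hi') hδ0
    have hi0 : 0 ≤ (i : ℝ) * δ := by positivity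
    have e1 : h (ξ N i) * δ - ∫ t in (a + i * δ)..(a + (i + 1 : ℕ) * δ), h t =
        ∫ t in (a + i * δ)..(a + (i + 1 : ℕ) * δ), (h (ξ N i) - h t) := by
      rw [intervalIntegral.integral_sub (by simp) (hc.intervalIntegrable _ _),
        intervalIntegral.integral_const, e, smul_eq_mul, mul_comm]
    rw [e1]
    have := intervalIntegral.norm_integral_le_of_norm_le_const
      (f := fun t => h (ξ N i) - h t) (a := a + i * δ) (b := a + (i + 1 : ℕ) * δ)
      (C := ε / (b - a + 1)) fun t ht => ?_
    · rwa [e, abs_of_nonneg hδ0] at this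
    · rw [Set.uIoc_of_le (by linarith)] at ht
      have h1 := hξ N i hi'
      rw [← hδ] at h1
      rw [← dist_eq_norm]
      refine (hu _ ?_ _ ?_ ?_).le
      · exact ⟨by linarith [h1.1], by linarith [h1.2]⟩
      · exact ⟨by linarith [ht.1], by linarith [ht.2]⟩
      · rw [Real.dist_eq, abs_lt]
        constructor <;> linarith [h1.1, h1.2, ht.1, ht.2]
  rw [Real.dist_eq, hsplit, ← Finset.sum_sub_distrib]
  refine (Finset.abs_sum_le_sum_abs _ _).trans_lt ((Finset.sum_le_sum hterm).trans_lt ?_)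
  rw [Finset.sum_const, Finset.card_range, nsmul_eq_mul,
    show (N : ℝ) * (ε / (b - a + 1) * δ) = ε / (b - a + 1) * (N * δ) by ring, hNδ,
    div_mul_eq_mul_div, div_lt_iff₀ (by linarith)]
  nlinarith

/-- Passing to the limit in exponential moment bounds. -/
lemma lintegral_exp_le_of_tendsto {Ω : Type*} [MeasurableSpace Ω] {P : Measure Ω}
    {Y S : ℕ → Ω → ℝ} {Z : Ω → ℝ} {B : ENNReal} (θ : ℝ) (hY : ∀ n, Measurable (Y n))
    (hS : ∀ n, Measurable (S n))
    (hYS : Tendsto (fun n => ∫⁻ ω, ‖Y n ω - S n ω‖ₑ ∂P) atTop (nhds 0))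
    (hSZ : ∀ᵐ ω ∂P, Tendsto (fun n => S n ω) atTop (nhds (Z ω)))
    (hB : ∀ n, ∫⁻ ω, ENNReal.ofReal (Real.exp (θ * Y n ω)) ∂P ≤ B) :
    ∫⁻ ω, ENNReal.ofReal (Real.exp (θ * Z ω)) ∂P ≤ B := by
  have h1 : TendstoInMeasure P (fun n ω => Y n ω - S n ω) atTop fun _ => 0 := by
    refine tendstoInMeasure_of_tendsto_eLpNorm (p := 1) one_ne_zero
      (fun n => ((hY n).sub (hS n)).aestronglyMeasurable) aestronglyMeasurable_const ?_
    simpa [eLpNorm_one_eq_lintegral_enorm] using hYS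
  obtain ⟨ns, hns, hae⟩ := h1.exists_seq_tendsto_ae
  have h2 : ∀ᵐ ω ∂P, ENNReal.ofReal (Real.exp (θ * Z ω)) =
      liminf (fun k => ENNReal.ofReal (Real.exp (θ * Y (ns k) ω))) atTop := by
    filter_upwards [hae, hSZ] with ω h3 h4
    have h5 : Tendsto (fun k => Y (ns k) ω) atTop (nhds (Z ω)) := by
      simpa using h3.add (h4.comp hns.tendsto_atTop)
    refine (Tendsto.liminf_eq ?_).symm
    exact (ENNReal.continuous_ofReal.comp Real.continuous_exp).continuousAt.tendsto.comp
      (h5.const_mul θ)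
  rw [lintegral_congr_ae h2]
  have hm : ∀ k, Measurable fun ω => ENNReal.ofReal (Real.exp (θ * Y (ns k) ω)) := fun k => by
    have := hY (ns k); fun_prop
  refine (lintegral_liminf_le hm).trans ?_
  refine (liminf_le_liminf (Eventually.of_forall fun k => hB (ns k))).trans ?_
  simp

/-- A uniformly continuous bounded function has a modulus of continuity `ε + κ u²`. -/
lemma exists_modulus_of_uniformContinuous {E α : Type*} [NormedAddCommGroup E]
    [PseudoMetricSpace α] {G : α × E → ℝ}
    (hG : UniformContinuous G) (h1 : ∀ q, |G q| ≤ 1) {ε : ℝ} (hε : 0 < ε) :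
    ∃ κ : ℝ, 0 ≤ κ ∧ ∀ p x v, |G (p, x + v) - G (p, x)| ≤ ε + κ * ‖v‖ ^ 2 := by
  obtain ⟨η, hη, hu⟩ := Metric.uniformContinuous_iff.1 hG ε hε
  refine ⟨2 / η ^ 2, by positivity, fun p x v => ?_⟩
  by_cases hv : ‖v‖ < η
  · have := hu (a := (p, x + v)) (b := (p, x)) (by simpa [Prod.dist_eq, hη] using hv)
    rw [Real.dist_eq] at this
    have h2 : 0 ≤ 2 / η ^ 2 * ‖v‖ ^ 2 := by positivity
    linarith
  · have h2 : 2 ≤ 2 / η ^ 2 * ‖v‖ ^ 2 := by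
      rw [div_mul_eq_mul_div, le_div_iff₀ (by positivity)]
      have : η ^ 2 ≤ ‖v‖ ^ 2 := by gcongr; exact not_lt.1 hv
      linarith
    have := abs_sub (G (p, x + v)) (G (p, x))
    linarith [h1 (p, x + v), h1 (p, x)]

section Primitive

variable {d : ℕ} (c : Fin d) {g : EuclideanSpace ℝ (Fin d) → ℝ}

/-- The primitive of `g` along the `c`-th coordinate direction, over a segment of length `r`. -/
def linePrimitive (c : Fin d) (r : ℝ) (g : EuclideanSpace ℝ (Fin d) → ℝ)
    (x : EuclideanSpace ℝ (Fin d)) : ℝ :=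
  ∫ u in (0 : ℝ)..r, g (x + EuclideanSpace.single c u)

lemma continuous_euclideanSingle : Continuous fun u : ℝ => EuclideanSpace.single c u := by
  have : (fun u : ℝ => EuclideanSpace.single c u) =
      fun u : ℝ => u • EuclideanSpace.single c (1 : ℝ) := by
    ext u i; simp
  rw [this]; fun_prop

lemma euclideanSingle_add (u v : ℝ) : EuclideanSpace.single c (u + v) =
    EuclideanSpace.single c u + EuclideanSpace.single c v := by
  ext i; by_cases h : i = c <;> simp [h]

lemma continuous_linePrimitive (hg : Continuous g) (r : ℝ) : Continuous (linePrimitive c r g) := by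
  have := continuous_euclideanSingle c
  exact intervalIntegral.continuous_parametric_intervalIntegral_of_continuous' (by fun_prop) _ _

lemma abs_linePrimitive_le (h1 : ∀ x, |g x| ≤ 1) (r : ℝ) (x : EuclideanSpace ℝ (Fin d)) :
    |linePrimitive c r g x| ≤ |r| := by
  have := intervalIntegral.norm_integral_le_of_norm_le_const (a := 0) (b := r) (C := 1)
    (f := fun u => g (x + EuclideanSpace.single c u)) fun u _ => h1 _
  simpa [linePrimitive] using this

lemma abs_integral_sub_mul_le (hg : Continuous g) {ε κ : ℝ} (hκ : 0 ≤ κ)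
    (hmod : ∀ x v, |g (x + v) - g x| ≤ ε + κ * ‖v‖ ^ 2) (x : EuclideanSpace ℝ (Fin d)) (v : ℝ) :
    |(∫ u in (0 : ℝ)..v, g (x + EuclideanSpace.single c u)) - v * g x| ≤
      (ε + κ * v ^ 2) * |v| := by
  have hs := continuous_euclideanSingle c
  have e : (∫ u in (0 : ℝ)..v, g (x + EuclideanSpace.single c u)) - v * g x =
      ∫ u in (0 : ℝ)..v, (g (x + EuclideanSpace.single c u) - g x) := by
    rw [intervalIntegral.integral_sub (Continuous.intervalIntegrable (by fun_prop) _ _) (by simp)]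
    simp
  rw [e]
  have := intervalIntegral.norm_integral_le_of_norm_le_const (a := 0) (b := v) (C := ε + κ * v ^ 2)
    (f := fun u => g (x + EuclideanSpace.single c u) - g x) fun u hu => ?_
  · simpa using this
  · refine (hmod _ _).trans ?_
    rw [PiLp.norm_single, Real.norm_eq_abs, sq_abs]
    have : u ^ 2 ≤ v ^ 2 := by
      rw [sq_le_sq]
      rcases le_total 0 v with h | h
      · rw [Set.uIoc_of_le h] at hu
        rw [abs_of_pos hu.1, abs_of_nonneg h]; exact hu.2
      · rw [Set.uIoc_of_ge h] at hu
        rw [abs_of_nonpos hu.2, abs_of_nonpos h]; linarith [hu.1]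
    gcongr

lemma abs_linePrimitive_add_sub_le (hg : Continuous g) {ε κ : ℝ} (hκ : 0 ≤ κ)
    (hmod : ∀ x v, |g (x + v) - g x| ≤ ε + κ * ‖v‖ ^ 2) (r : ℝ)
    (x : EuclideanSpace ℝ (Fin d)) (v : ℝ) :
    |linePrimitive c r g (x + EuclideanSpace.single c v) - linePrimitive c r g x -
      v * (g (x + EuclideanSpace.single c r) - g x)| ≤ 2 * ((ε + κ * v ^ 2) * |v|) := by
  have hs := continuous_euclideanSingle c
  set H : ℝ → ℝ := fun u => g (x + EuclideanSpace.single c u) with hH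
  have hHc : Continuous H := by fun_prop
  have hi (p q : ℝ) : IntervalIntegrable H volume p q := hHc.intervalIntegrable _ _
  have e1 : linePrimitive c r g (x + EuclideanSpace.single c v) = ∫ u in v..(v + r), H u := by
    have := intervalIntegral.integral_comp_add_left (a := 0) (b := r) H v
    rw [add_zero] at this
    rw [← this]
    simp only [linePrimitive, hH, euclideanSingle_add, add_assoc]
  have e2 : (∫ u in r..(v + r), H u) =
      ∫ u in (0 : ℝ)..v, g (x + EuclideanSpace.single c r + EuclideanSpace.single c u) := by
    have := intervalIntegral.integral_comp_add_right (a := 0) (b := v) H r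
    rw [zero_add] at this
    rw [← this]
    simp only [hH, euclideanSingle_add, add_comm, add_left_comm]
  have e3 : (∫ u in v..(v + r), H u) - (∫ u in (0 : ℝ)..r, H u) =
      (∫ u in r..(v + r), H u) - ∫ u in (0 : ℝ)..v, H u := by
    have h1 := intervalIntegral.integral_add_adjacent_intervals (hi 0 v) (hi v (v + r))
    have h2 := intervalIntegral.integral_add_adjacent_intervals (hi 0 r) (hi r (v + r))
    linarith
  have b1 := abs_integral_sub_mul_le c hg hκ hmod (x + EuclideanSpace.single c r) v
  have b2 := abs_integral_sub_mul_le c hg hκ hmod x v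
  have e4 : linePrimitive c r g x = ∫ u in (0 : ℝ)..r, H u := rfl
  rw [e1, e4, e3, e2]
  rw [abs_le] at b1 b2 ⊢
  constructor <;> linarith [b1.1, b1.2, b2.1, b2.2]

end Primitive

section Covariation

variable {Ω : Type*} [MeasurableSpace Ω] {P : Measure Ω} [IsProbabilityMeasure P] {d : ℕ} {s : ℝ}
  {τ : ℕ → ℝ} {X : ℕ × Fin d → Ω → ℝ} {g : ℕ → EuclideanSpace ℝ (Fin d) → ℝ}

lemma mixPt_eq_pathPt_add (c : Fin d) (i : ℕ) (p : ℕ × Fin d → ℝ) :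
    mixPt c i p = pathPt i p + EuclideanSpace.single c (p (i + 1, c) - p (i, c)) := by
  ext c'
  by_cases h : c' = c
  · subst h; simp [mixPt, pathPt]
  · simp [mixPt, pathPt, h]

/-- The covariation sum of a primitive is close in `L¹` to the Riemann sum of the derivative. -/
lemma IsSampledBM.lintegral_covariation_sub_le (hX : IsSampledBM P s τ X) (c : Fin d) (r : ℝ)
    (hg : ∀ i, Continuous (g i)) (h1 : ∀ i x, |g i x| ≤ 1) {ε κ : ℝ} (hε : 0 < ε) (hκ : 0 ≤ κ)
    (hmod : ∀ i x v, |g i (x + v) - g i x| ≤ ε + κ * ‖v‖ ^ 2) (N : ℕ) :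
    ∫⁻ ω, ‖(∑ i ∈ Finset.range N, (linePrimitive c r (g i) (mixPt c i fun q => X q ω) -
      linePrimitive c r (g i) (pathPt i fun q => X q ω)) * (X (i + 1, c) ω - X (i, c) ω)) -
      ∑ i ∈ Finset.range N, (g i ((pathPt i fun q => X q ω) + EuclideanSpace.single c r) -
        g i (pathPt i fun q => X q ω)) * (s * (τ (i + 1) - τ i))‖ₑ ∂P ≤
      ENNReal.ofReal (ε + 2 ^ 2 * gaussianSqVar *
        (∑ i ∈ Finset.range N, (s * (τ (i + 1) - τ i)) ^ 2) / ε +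
        2 * ∑ i ∈ Finset.range N, (ε * (s * (τ (i + 1) - τ i)) +
          κ * (gaussianFourth * (s * (τ (i + 1) - τ i)) ^ 2))) := by
  have hXm := hX.measurable
  have hp := hX.measurable_path
  set f : ℕ → EuclideanSpace ℝ (Fin d) → ℝ := fun i x =>
    g i (x + EuclideanSpace.single c r) - g i x with hf
  have hfm (i : ℕ) : Measurable (f i) := by
    have := hg i
    exact Continuous.measurable (by fun_prop)
  have hf2 (i : ℕ) (x : EuclideanSpace ℝ (Fin d)) : |f i x| ≤ 2 := by
    have := abs_sub (g i (x + EuclideanSpace.single c r)) (g i x)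
    have := h1 i (x + EuclideanSpace.single c r)
    have := h1 i x
    simp only [hf]; linarith
  have hv (i : ℕ) : ((s * (τ (i + 1) - τ i)).toNNReal : ℝ) = s * (τ (i + 1) - τ i) :=
    Real.coe_toNNReal _ (mul_nonneg hX.pos.le (sub_nonneg.2 (hX.mono (Nat.le_succ i))))
  set ξ : ℕ → Ω → ℝ := fun i ω => X (i + 1, c) ω - X (i, c) ω with hξ
  have hξm (i : ℕ) : Measurable (ξ i) := by fun_prop
  have hξl (i : ℕ) : P.map (ξ i) = gaussianReal 0 (s * (τ (i + 1) - τ i)).toNNReal :=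
    hX.map_increment i c
  obtain ⟨hML, hMb⟩ := hX.integral_sum_sq_forward_le c hfm hf2 N
  set M : Ω → ℝ := fun ω => ∑ i ∈ Finset.range N, f i (pathPt i fun q => X q ω) *
      (ξ i ω ^ 2 - s * (τ (i + 1) - τ i)) with hM
  have hMi : Integrable (fun ω => M ω ^ 2) P := hML.integrable_sq
  have hR1 (i : ℕ) : Integrable (fun ω => ξ i ω ^ 2) P :=
    integrable_pow_of_map_gaussianReal (hξm i) (hξl i) 2
  have hR2 (i : ℕ) : Integrable (fun ω => ξ i ω ^ 4) P :=
    integrable_pow_of_map_gaussianReal (hξm i) (hξl i) 4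
  have hRi (i : ℕ) : Integrable (fun ω => ε * ξ i ω ^ 2 + κ * ξ i ω ^ 4) P :=
    ((hR1 i).const_mul _).add ((hR2 i).const_mul _)
  have hRs : Integrable (fun ω => ∑ i ∈ Finset.range N, (ε * ξ i ω ^ 2 + κ * ξ i ω ^ 4)) P :=
    integrable_finsetSum _ fun i _ => hRi i
  have hpt (ω : Ω) : |(∑ i ∈ Finset.range N,
      (linePrimitive c r (g i) (mixPt c i fun q => X q ω) -
      linePrimitive c r (g i) (pathPt i fun q => X q ω)) * (X (i + 1, c) ω - X (i, c) ω)) -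
      ∑ i ∈ Finset.range N, f i (pathPt i fun q => X q ω) * (s * (τ (i + 1) - τ i))| ≤
      ε + M ω ^ 2 / ε + 2 * ∑ i ∈ Finset.range N, (ε * ξ i ω ^ 2 + κ * ξ i ω ^ 4) := by
    have hMle : |M ω| ≤ ε + M ω ^ 2 / ε := by
      have : |M ω| * ε ≤ (ε + M ω ^ 2 / ε) * ε := by
        rw [add_mul, div_mul_cancel₀ _ hε.ne', ← sq_abs (M ω)]
        nlinarith [sq_nonneg (|M ω| - ε), sq_nonneg (|M ω|), sq_nonneg ε, abs_nonneg (M ω)]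
      exact le_of_mul_le_mul_right this hε
    have e : (∑ i ∈ Finset.range N,
      (linePrimitive c r (g i) (mixPt c i fun q => X q ω) -
      linePrimitive c r (g i) (pathPt i fun q => X q ω)) * (X (i + 1, c) ω - X (i, c) ω)) -
      ∑ i ∈ Finset.range N, f i (pathPt i fun q => X q ω) * (s * (τ (i + 1) - τ i)) =
      M ω + ∑ i ∈ Finset.range N, (linePrimitive c r (g i) (mixPt c i fun q => X q ω) -
        linePrimitive c r (g i) (pathPt i fun q => X q ω) -
        ξ i ω * f i (pathPt i fun q => X q ω)) * ξ i ω := by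
      rw [hM, ← Finset.sum_sub_distrib, ← Finset.sum_add_distrib]
      refine Finset.sum_congr rfl fun i _ => ?_
      simp only [hξ]
      ring
    rw [e]
    refine (abs_add_le _ _).trans (add_le_add hMle ?_)
    rw [Finset.mul_sum]
    refine (Finset.abs_sum_le_sum_abs _ _).trans (Finset.sum_le_sum fun i _ => ?_)
    have h2 := abs_linePrimitive_add_sub_le c (hg i) hκ (hmod i) r (pathPt i fun q => X q ω)
      (ξ i ω)
    rw [abs_mul, mixPt_eq_pathPt_add]
    refine (mul_le_mul_of_nonneg_right h2 (abs_nonneg _)).trans (le_of_eq ?_)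
    rw [← sq_abs (ξ i ω), show ξ i ω ^ 4 = (ξ i ω ^ 2) ^ 2 by ring, ← sq_abs (ξ i ω)]
    ring
  have hAi : Integrable (fun ω => ε + M ω ^ 2 / ε) P := (integrable_const _).add (hMi.div_const _)
  have hBi : Integrable (fun ω => ε + M ω ^ 2 / ε +
      2 * ∑ i ∈ Finset.range N, (ε * ξ i ω ^ 2 + κ * ξ i ω ^ 4)) P := hAi.add (hRs.const_mul _)
  calc _ ≤ ∫⁻ ω, ENNReal.ofReal (ε + M ω ^ 2 / ε +
        2 * ∑ i ∈ Finset.range N, (ε * ξ i ω ^ 2 + κ * ξ i ω ^ 4)) ∂P := by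
        refine lintegral_mono fun ω => ?_
        rw [Real.enorm_eq_ofReal_abs]
        exact ENNReal.ofReal_le_ofReal (hpt ω)
    _ = ENNReal.ofReal (∫ ω, (ε + M ω ^ 2 / ε +
        2 * ∑ i ∈ Finset.range N, (ε * ξ i ω ^ 2 + κ * ξ i ω ^ 4)) ∂P) := by
        rw [ofReal_integral_eq_lintegral_ofReal hBi]
        exact ae_of_all _ fun ω => (abs_nonneg _).trans (hpt ω)
    _ ≤ _ := by
        refine ENNReal.ofReal_le_ofReal ?_
        rw [integral_add hAi (hRs.const_mul _),
          integral_add (integrable_const _) (hMi.div_const _), integral_div, integral_const_mul,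
          integral_finsetSum _ fun i _ => hRi i]
        have e3 (i : ℕ) : ∫ ω, (ε * ξ i ω ^ 2 + κ * ξ i ω ^ 4) ∂P =
            ε * (s * (τ (i + 1) - τ i)) + κ * (gaussianFourth * (s * (τ (i + 1) - τ i)) ^ 2) := by
          rw [integral_add ((hR1 i).const_mul _) ((hR2 i).const_mul _), integral_const_mul,
            integral_const_mul, integral_sq_of_map_gaussianReal (hξm i) (hξl i),
            integral_pow_four_of_map_gaussianReal (hξm i) (hξl i), hv]
        simp only [e3, integral_const, probReal_univ, one_smul]
        gcongr

end Covariation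

section Slice

variable {Ω : Type*} [MeasurableSpace Ω] {P : Measure Ω} {d : ℕ}
  {W : ℝ × ℝ → Ω → EuclideanSpace ℝ (Fin d)}

/-- The sheet, extended continuously to the plane. -/
def clampedSheet (W : ℝ × ℝ → Ω → EuclideanSpace ℝ (Fin d)) (p : ℝ × ℝ) (ω : Ω) :
    EuclideanSpace ℝ (Fin d) :=
  W (squareClamp p) ω

lemma IsBrownianSheet.continuous_clampedSheet (hW : IsBrownianSheet P d W) (ω : Ω) :
    Continuous fun p => clampedSheet W p ω :=
  (hW.2.1 ω).comp_continuous continuous_squareClamp squareClamp_mem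

lemma IsBrownianSheet.measurable_clampedSheet (hW : IsBrownianSheet P d W) :
    Measurable fun q : (ℝ × ℝ) × Ω => clampedSheet W q.1 q.2 :=
  measurable_uncurry_of_continuous_of_measurable (u := clampedSheet W)
    hW.continuous_clampedSheet fun p => hW.1 (squareClamp p)

lemma IsBrownianSheet.isSampledBM [IsProbabilityMeasure P] (hW : IsBrownianSheet P d W) {s : ℝ}
    (h0 : 0 < s) (h1 : s ≤ 1) {τ : ℕ → ℝ} (hτ : Monotone τ) (hτ0 : ∀ i, 0 ≤ τ i)
    (hτ1 : ∀ i, τ i ≤ 1) :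
    IsSampledBM P s τ fun (q : ℕ × Fin d) ω => clampedSheet W (s, τ q.1) ω q.2 where
  gaussian := hW.isGaussianProcess.comp_right fun q : ℕ × Fin d => ((s, τ q.1), q.2)
  measurable q := hW.measurable_coord ((s, τ q.1), q.2)
  mean q := hW.integral_eval ((s, τ q.1), q.2)
  cov q r := by
    refine (hW.covariance_eval ((s, τ q.1), q.2) ((s, τ r.1), r.2)).trans ?_
    simp only [sheetCov, squareClamp, unitClamp_eq_self h0.le h1,
      unitClamp_eq_self (hτ0 _) (hτ1 _), min_self]
  pos := h0
  mono := hτ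
  nonneg := hτ0

/-- The equidistant mesh of `[a, b]` with `N` steps. -/
def mesh (a b : ℝ) (N i : ℕ) : ℝ := unitClamp (a + i * ((b - a) / N))

lemma mesh_eq {a b : ℝ} (ha : 0 ≤ a) (hab : a ≤ b) (hb : b ≤ 1) {N i : ℕ} (hi : i ≤ N) :
    mesh a b N i = a + i * ((b - a) / N) := by
  have h0 : 0 ≤ (i : ℝ) * ((b - a) / N) := by
    have : 0 ≤ b - a := by linarith
    positivity
  refine unitClamp_eq_self (by linarith) ?_
  rcases Nat.eq_zero_or_pos N with h | h
  · subst h; simp; linarith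
  · have hN : (0 : ℝ) < N := by exact_mod_cast h
    have : (i : ℝ) * ((b - a) / N) ≤ N * ((b - a) / N) := by
      have : 0 ≤ b - a := by linarith
      gcongr
    rw [mul_div_cancel₀ _ hN.ne'] at this
    linarith

lemma mesh_mono {a b : ℝ} (hab : a ≤ b) (N : ℕ) : Monotone (mesh a b N) := fun i j h => by
  refine unitClamp_mono ?_
  have : 0 ≤ b - a := by linarith
  gcongr

/-- The increment of `g` between `W_{s,t} + x` and `W_{s,t} + x + r e_c`. -/
def sheetDiff (W : ℝ × ℝ → Ω → EuclideanSpace ℝ (Fin d)) (c : Fin d) (r : ℝ)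
    (x : EuclideanSpace ℝ (Fin d)) (g : (ℝ × ℝ) × EuclideanSpace ℝ (Fin d) → ℝ)
    (p : ℝ × ℝ) (ω : Ω) : ℝ :=
  g (p, clampedSheet W p ω + (x + EuclideanSpace.single c r)) - g (p, clampedSheet W p ω + x)

variable {g : (ℝ × ℝ) × EuclideanSpace ℝ (Fin d) → ℝ}

lemma IsBrownianSheet.continuous_sheetDiff (hW : IsBrownianSheet P d W) (hg : Continuous g)
    (c : Fin d) (r : ℝ) (x : EuclideanSpace ℝ (Fin d)) (ω : Ω) :
    Continuous fun p => sheetDiff W c r x g p ω := by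
  have := hW.continuous_clampedSheet ω
  unfold sheetDiff; fun_prop

lemma IsBrownianSheet.measurable_sheetDiff (hW : IsBrownianSheet P d W) (hg : Measurable g)
    (c : Fin d) (r : ℝ) (x : EuclideanSpace ℝ (Fin d)) :
    Measurable fun q : (ℝ × ℝ) × Ω => sheetDiff W c r x g q.1 q.2 := by
  have := hW.measurable_clampedSheet
  unfold sheetDiff; fun_prop

omit [MeasurableSpace Ω] in
lemma abs_sheetDiff_le (h1 : ∀ q, |g q| ≤ 1) (c : Fin d) (r : ℝ) (x : EuclideanSpace ℝ (Fin d))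
    (p : ℝ × ℝ) (ω : Ω) : |sheetDiff W c r x g p ω| ≤ 2 :=
  (abs_sub _ _).trans (by
    linarith [h1 (p, clampedSheet W p ω + (x + EuclideanSpace.single c r)),
      h1 (p, clampedSheet W p ω + x)])

/-- Exponential moments of the averaged increment of a continuous function along a line in time. -/
lemma IsBrownianSheet.lintegral_exp_slice_le [IsProbabilityMeasure P] (hW : IsBrownianSheet P d W)
    (hg : UniformContinuous g) (h1 : ∀ q, |g q| ≤ 1) (c : Fin d) (r : ℝ)
    (x : EuclideanSpace ℝ (Fin d)) {s a b : ℝ} (hs0 : 0 < s) (hs1 : s ≤ 1) (ha : 0 ≤ a)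
    (hab : a ≤ b) (hb : b ≤ 1) (θ : ℝ) :
    ∫⁻ ω, ENNReal.ofReal (Real.exp (θ * (s * ∫ t in a..b, sheetDiff W c r x g (s, t) ω))) ∂P ≤
      2 * ENNReal.ofReal (Real.exp (18 * (θ ^ 2 * r ^ 2 * (s * (b - a))))) := by
  have hgc := hg.continuous
  set X : ℕ → ℕ × Fin d → Ω → ℝ := fun N q ω => clampedSheet W (s, mesh a b N q.1) ω q.2 with hXdef
  have hX (N : ℕ) : IsSampledBM P s (mesh a b N) (X N) :=
    hW.isSampledBM hs0 hs1 (mesh_mono hab N) (fun i => unitClamp_nonneg _)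
      fun i => unitClamp_le_one _
  set γ : ℕ → ℕ → EuclideanSpace ℝ (Fin d) → ℝ :=
    fun N i y => g ((s, mesh a b N i), y + x) with hγ
  have hγc (N i : ℕ) : Continuous (γ N i) := by fun_prop
  have hγ1 (N i : ℕ) (y : EuclideanSpace ℝ (Fin d)) : |γ N i y| ≤ 1 := h1 _
  have hpath (N i : ℕ) (ω : Ω) :
      (pathPt i fun q => X N q ω) = clampedSheet W (s, mesh a b N i) ω := by
    ext; simp [pathPt, hXdef]
  set Y : ℕ → Ω → ℝ := fun N ω => ∑ i ∈ Finset.range (N + 1),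
    (linePrimitive c r (γ (N + 1) i) (mixPt c i fun q => X (N + 1) q ω) -
      linePrimitive c r (γ (N + 1) i) (pathPt i fun q => X (N + 1) q ω)) *
      (X (N + 1) (i + 1, c) ω - X (N + 1) (i, c) ω) with hY
  set S : ℕ → Ω → ℝ := fun N ω => ∑ i ∈ Finset.range (N + 1),
    (γ (N + 1) i ((pathPt i fun q => X (N + 1) q ω) + EuclideanSpace.single c r) -
      γ (N + 1) i (pathPt i fun q => X (N + 1) q ω)) *
      (s * (mesh a b (N + 1) (i + 1) - mesh a b (N + 1) i)) with hS
  have hFm (N i : ℕ) : Measurable (linePrimitive c r (γ N i)) :=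
    (continuous_linePrimitive c (hγc N i) r).measurable
  have hstep (N i : ℕ) (hi : i ∈ Finset.range (N + 1)) :
      mesh a b (N + 1) (i + 1) - mesh a b (N + 1) i = (b - a) / (N + 1 : ℕ) := by
    rw [mesh_eq ha hab hb (by simpa using hi), mesh_eq ha hab hb (Finset.mem_range.1 hi).le]
    push_cast; ring
  refine lintegral_exp_le_of_tendsto (Y := Y) (S := S) θ (fun N => ?_) (fun N => ?_) ?_
    (ae_of_all _ fun ω => ?_) fun N => ?_
  · have h2 := (hX (N + 1)).measurable
    have h3 := (hX (N + 1)).measurable_path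
    have := hFm (N + 1)
    fun_prop
  · have h2 := (hX (N + 1)).measurable
    have h3 := (hX (N + 1)).measurable_path
    have h4 := fun i => (hγc (N + 1) i).measurable
    fun_prop
  · have hub : ∀ ε : ℝ, 0 < ε → ∃ C : ℝ, ∀ N : ℕ, ∫⁻ ω, ‖Y N ω - S N ω‖ₑ ∂P ≤
        ENNReal.ofReal (ε * (1 + 2 * (s * (b - a))) + C / (N + 1 : ℕ)) := by
      intro ε hε
      obtain ⟨κ, hκ, hmod⟩ := exists_modulus_of_uniformContinuous hg h1 hε
      refine ⟨2 ^ 2 * gaussianSqVar * (s * (b - a)) ^ 2 / ε +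
        2 * (κ * (gaussianFourth * (s * (b - a)) ^ 2)), fun N => ?_⟩
      have := (hX (N + 1)).lintegral_covariation_sub_le c r (hγc (N + 1)) (hγ1 (N + 1)) hε hκ
        (fun i y v => by
          simp only [hγ]
          rw [add_right_comm]
          exact hmod _ _ _) (N + 1)
      refine this.trans (le_of_eq ?_)
      have e1 : ∑ i ∈ Finset.range (N + 1),
          (s * (mesh a b (N + 1) (i + 1) - mesh a b (N + 1) i)) ^ 2 =
          ∑ i ∈ Finset.range (N + 1), (s * ((b - a) / (N + 1 : ℕ))) ^ 2 :=
        Finset.sum_congr rfl fun i hi => by rw [hstep N i hi]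
      have e2 : ∑ i ∈ Finset.range (N + 1),
          (ε * (s * (mesh a b (N + 1) (i + 1) - mesh a b (N + 1) i)) +
            κ * (gaussianFourth * (s * (mesh a b (N + 1) (i + 1) - mesh a b (N + 1) i)) ^ 2)) =
          ∑ i ∈ Finset.range (N + 1), (ε * (s * ((b - a) / (N + 1 : ℕ))) +
            κ * (gaussianFourth * (s * ((b - a) / (N + 1 : ℕ))) ^ 2)) :=
        Finset.sum_congr rfl fun i hi => by rw [hstep N i hi]
      rw [e1, e2, Finset.sum_const, Finset.sum_const, Finset.card_range, nsmul_eq_mul, nsmul_eq_mul]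
      have hN : ((N + 1 : ℕ) : ℝ) ≠ 0 := by positivity
      congr 1
      field_simp
      ring
    rw [ENNReal.tendsto_atTop_zero]
    intro η hη
    by_cases hη' : η = ⊤
    · exact ⟨0, fun n _ => by simp [hη']⟩
    have hη0 : 0 < η.toReal := ENNReal.toReal_pos hη.ne' hη'
    have hT : 0 < 1 + 2 * (s * (b - a)) := by
      have : 0 ≤ s * (b - a) := mul_nonneg hs0.le (by linarith)
      linarith
    obtain ⟨C, hC⟩ := hub (η.toReal / 2 / (1 + 2 * (s * (b - a)))) (by positivity)
    have hlim : Tendsto (fun N : ℕ => C / ((N + 1 : ℕ) : ℝ)) atTop (nhds 0) :=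
      (tendsto_const_div_atTop_nhds_zero_nat C).comp (tendsto_add_atTop_nat 1)
    obtain ⟨M, hM⟩ := eventually_atTop.1 (hlim.eventually (ge_mem_nhds (half_pos hη0)))
    refine ⟨M, fun N hN => (hC N).trans ?_⟩
    rw [div_mul_cancel₀ _ hT.ne', ENNReal.ofReal_le_iff_le_toReal hη']
    linarith [hM N hN]
  · have hc : Continuous fun t => s * sheetDiff W c r x g (s, t) ω := by
      have := hW.continuous_sheetDiff hgc c r x ω
      fun_prop
    have := tendsto_riemannSum hc hab (fun N i => a + i * ((b - a) / N)) fun N i hi => by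
      refine ⟨le_rfl, ?_⟩
      have : 0 ≤ b - a := by linarith
      gcongr
      simp
    rw [intervalIntegral.integral_const_mul] at this
    refine (this.comp (tendsto_add_atTop_nat 1)).congr fun N => ?_
    refine Finset.sum_congr rfl fun i hi => ?_
    rw [hstep N i hi, hpath, ← mesh_eq ha hab hb (Finset.mem_range.1 hi).le]
    simp only [sheetDiff, hγ]
    rw [add_assoc, add_comm (EuclideanSpace.single c r) x]
    ring
  · have := (hX (N + 1)).lintegral_exp_covariation_le c (hFm (N + 1)) (K := |r|)
      (fun i y => abs_linePrimitive_le c (hγ1 (N + 1) i) r y) (N + 1) θ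
    refine this.trans (le_of_eq ?_)
    rw [sq_abs, mesh_eq ha hab hb le_rfl, mesh_eq ha hab hb (Nat.zero_le _)]
    have hN : ((N + 1 : ℕ) : ℝ) ≠ 0 := by positivity
    congr 6
    field_simp
    push_cast
    ring

end Slice

/-- Lebesgue measure on the rectangle `(α, β] × (a, b]`. -/
def rectMeasure (α β a b : ℝ) : Measure (ℝ × ℝ) :=
  (volume.restrict (Set.Ioc α β)).prod (volume.restrict (Set.Ioc a b))

instance (α β a b : ℝ) : IsFiniteMeasure (rectMeasure α β a b) := by
  unfold rectMeasure; infer_instance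

lemma integrable_rectMeasure {α β a b : ℝ} {F : ℝ × ℝ → ℝ} (hF : Measurable F) {C : ℝ}
    (hC : ∀ p, |F p| ≤ C) : Integrable F (rectMeasure α β a b) :=
  Integrable.of_bound hF.aestronglyMeasurable C (ae_of_all _ hC)

lemma integral_rectMeasure {α β a b : ℝ} {F : ℝ × ℝ → ℝ} (hF : Measurable F) {C : ℝ}
    (hC : ∀ p, |F p| ≤ C) : ∫ p, F p ∂(rectMeasure α β a b) =
      ∫ s in Set.Ioc α β, ∫ t in Set.Ioc a b, F (s, t) :=
  integral_prod _ (integrable_rectMeasure hF hC)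

section Rect

variable {Ω : Type*} [MeasurableSpace Ω] {P : Measure Ω} [IsProbabilityMeasure P] {d : ℕ}
  {W : ℝ × ℝ → Ω → EuclideanSpace ℝ (Fin d)} {g : (ℝ × ℝ) × EuclideanSpace ℝ (Fin d) → ℝ}

omit [IsProbabilityMeasure P] in
lemma IsBrownianSheet.measurable_slice (hW : IsBrownianSheet P d W) (hg : Measurable g)
    (c : Fin d) (r : ℝ) (x : EuclideanSpace ℝ (Fin d)) (s : ℝ) {a b : ℝ} (hab : a ≤ b) :
    Measurable fun ω => ∫ t in a..b, sheetDiff W c r x g (s, t) ω := by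
  simp only [intervalIntegral.integral_of_le hab]
  have h := hW.measurable_sheetDiff hg c r x
  have h2 : StronglyMeasurable fun q : Ω × ℝ => sheetDiff W c r x g (s, q.2) q.1 :=
    (h.comp (by fun_prop : Measurable fun q : Ω × ℝ => (((s, q.2), q.1) : (ℝ × ℝ) × Ω))).stronglyMeasurable
  exact h2.integral_prod_right.measurable

omit [IsProbabilityMeasure P] in
lemma IsBrownianSheet.measurable_integral_sheetDiff (hW : IsBrownianSheet P d W)
    (hg : Measurable g) (c : Fin d) (r : ℝ) (x : EuclideanSpace ℝ (Fin d)) (α β a b : ℝ) :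
    Measurable fun ω => ∫ p, sheetDiff W c r x g p ω ∂(rectMeasure α β a b) := by
  have h2 : StronglyMeasurable fun q : Ω × (ℝ × ℝ) => sheetDiff W c r x g q.2 q.1 :=
    ((hW.measurable_sheetDiff hg c r x).comp measurable_swap).stronglyMeasurable
  exact h2.integral_prod_right.measurable

lemma IsBrownianSheet.lintegral_exp_sum_slice_le (hW : IsBrownianSheet P d W)
    (hg : UniformContinuous g) (h1 : ∀ q, |g q| ≤ 1) (c : Fin d) (r : ℝ)
    (x : EuclideanSpace ℝ (Fin d)) {a b : ℝ} (ha : 0 ≤ a) (hab : a ≤ b) (hb : b ≤ 1)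
    {τ : ℕ → ℝ} (hτ : Monotone τ) (hτ0 : ∀ i, 0 ≤ τ i) (hτ1 : ∀ i, τ i ≤ 1) (N : ℕ) (θ : ℝ) :
    ∫⁻ ω, ENNReal.ofReal (Real.exp (θ * ∑ j ∈ Finset.range N,
      (∫ t in a..b, sheetDiff W c r x g (τ (j + 1), t) ω) * (τ (j + 1) - τ j))) ∂P ≤
      2 * ENNReal.ofReal (Real.exp (72 * (θ ^ 2 * r ^ 2 * ((τ N - τ 0) * (b - a))))) := by
  set Φ : ℕ → Ω → ℝ := fun j ω => ∫ t in a..b, sheetDiff W c r x g (τ (j + 1), t) ω with hΦ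
  have hΦm (j : ℕ) : Measurable (Φ j) :=
    hW.measurable_slice hg.continuous.measurable c r x _ hab
  set w : ℕ → ℝ := fun i => (τ (i + 1) - τ i) / Real.sqrt (τ (i + 1)) with hw
  have hd0 (i : ℕ) : 0 ≤ τ (i + 1) - τ i := sub_nonneg.2 (hτ (Nat.le_succ i))
  have hw0 (i : ℕ) : 0 ≤ w i := div_nonneg (hd0 i) (Real.sqrt_nonneg _)
  have hT : 0 ≤ τ N - τ 0 := sub_nonneg.2 (hτ (Nat.zero_le N))
  have hwe (i : ℕ) : τ (i + 1) - τ i = w i * Real.sqrt (τ (i + 1)) := by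
    rcases (hτ0 (i + 1)).eq_or_lt with h | h
    · have := hd0 i
      have := hτ0 i
      rw [← h]
      simp only [Real.sqrt_zero, mul_zero]
      linarith
    · rw [hw]
      have := Real.sqrt_pos.2 h
      field_simp
  have e (ω : Ω) : θ * ∑ j ∈ Finset.range N, Φ j ω * (τ (j + 1) - τ j) =
      ∑ j ∈ Finset.range N, w j * (θ * Real.sqrt (τ (j + 1)) * Φ j ω) := by
    rw [Finset.mul_sum]
    refine Finset.sum_congr rfl fun j _ => ?_
    rw [hwe]; ring
  change ∫⁻ ω, ENNReal.ofReal (Real.exp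
    (θ * ∑ j ∈ Finset.range N, Φ j ω * (τ (j + 1) - τ j))) ∂P ≤ _
  simp only [e]
  have hsum := sum_sub_div_sqrt_le hτ hτ0 N
  have hba : 0 ≤ b - a := by linarith
  have h1le : (1 : ENNReal) ≤
      ENNReal.ofReal (Real.exp (72 * (θ ^ 2 * r ^ 2 * ((τ N - τ 0) * (b - a))))) := by
    rw [← ENNReal.ofReal_one]
    exact ENNReal.ofReal_le_ofReal (Real.one_le_exp (by positivity))
  rcases (Finset.sum_nonneg fun i (_ : i ∈ Finset.range N) => hw0 i).eq_or_lt with h0 | h0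
  · have hz := (Finset.sum_eq_zero_iff_of_nonneg fun i _ => hw0 i).1 h0.symm
    have (ω : Ω) : ∑ i ∈ Finset.range N, w i * (θ * Real.sqrt (τ (i + 1)) * Φ i ω) = 0 :=
      Finset.sum_eq_zero fun i hi => by rw [hz i hi, zero_mul]
    simp only [this, Real.exp_zero, ENNReal.ofReal_one, lintegral_const, measure_univ, mul_one]
    exact le_trans h1le (le_mul_of_one_le_left zero_le (by norm_num))
  · set S := ∑ i ∈ Finset.range N, w i with hS
    have hS2 : S ^ 2 ≤ 4 * (τ N - τ 0) := by
      calc S ^ 2 ≤ (2 * Real.sqrt (τ N - τ 0)) ^ 2 := by gcongr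
        _ = 4 * (τ N - τ 0) := by rw [mul_pow, Real.sq_sqrt hT]; norm_num
    have hb (i : ℕ) : ∫⁻ ω, ENNReal.ofReal (Real.exp
        (S * (θ * Real.sqrt (τ (i + 1)) * Φ i ω))) ∂P ≤
        2 * ENNReal.ofReal (Real.exp (72 * (θ ^ 2 * r ^ 2 * ((τ N - τ 0) * (b - a))))) := by
      rcases (hτ0 (i + 1)).eq_or_lt with h | h
      · rw [← h]
        simp only [Real.sqrt_zero, mul_zero, zero_mul, Real.exp_zero, ENNReal.ofReal_one,
          lintegral_const, measure_univ, mul_one]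
        exact le_trans h1le (le_mul_of_one_le_left zero_le (by norm_num))
      · have hq := Real.sqrt_pos.2 h
        have := hW.lintegral_exp_slice_le hg h1 c r x h (hτ1 (i + 1)) ha hab hb
          (S * θ / Real.sqrt (τ (i + 1)))
        have e2 (ω : Ω) : S * (θ * Real.sqrt (τ (i + 1)) * Φ i ω) =
            S * θ / Real.sqrt (τ (i + 1)) * (τ (i + 1) * Φ i ω) := by
          field_simp
          rw [Real.sq_sqrt h.le]
          ring
        simp only [e2]
        refine this.trans (mul_le_mul_right
          (ENNReal.ofReal_le_ofReal (Real.exp_le_exp.2 ?_)) _)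
        have e3 : (S * θ / Real.sqrt (τ (i + 1))) ^ 2 * r ^ 2 * (τ (i + 1) * (b - a)) =
            S ^ 2 * (θ ^ 2 * r ^ 2 * (b - a)) := by
          rw [div_pow, Real.sq_sqrt h.le]
          field_simp
        rw [e3]
        have := mul_le_mul_of_nonneg_right hS2
          (by positivity : 0 ≤ θ ^ 2 * r ^ 2 * (b - a))
        nlinarith
    calc _ ≤ ∫⁻ ω, ∑ i ∈ Finset.range N, ENNReal.ofReal (w i / S) *
          ENNReal.ofReal (Real.exp (S * (θ * Real.sqrt (τ (i + 1)) * Φ i ω))) ∂P := by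
          refine lintegral_mono fun ω => ?_
          have := exp_sum_mul_le_sum (N := N) (w := w)
            (y := fun i => θ * Real.sqrt (τ (i + 1)) * Φ i ω) (fun i _ => hw0 i) h0
          simp_rw [← ENNReal.ofReal_mul (div_nonneg (hw0 _) h0.le)]
          rw [← ENNReal.ofReal_sum_of_nonneg
            fun i _ => mul_nonneg (div_nonneg (hw0 _) h0.le) (Real.exp_pos _).le]
          exact ENNReal.ofReal_le_ofReal this
      _ = ∑ i ∈ Finset.range N, ENNReal.ofReal (w i / S) *
          ∫⁻ ω, ENNReal.ofReal (Real.exp (S * (θ * Real.sqrt (τ (i + 1)) * Φ i ω))) ∂P := by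
          rw [lintegral_finsetSum _ fun i _ => by fun_prop]
          exact Finset.sum_congr rfl fun i _ => lintegral_const_mul _ (by fun_prop)
      _ ≤ ∑ i ∈ Finset.range N, ENNReal.ofReal (w i / S) *
          (2 * ENNReal.ofReal (Real.exp (72 * (θ ^ 2 * r ^ 2 * ((τ N - τ 0) * (b - a)))))) := by
          gcongr with i hi
          exact hb i
      _ = _ := by
          rw [← Finset.sum_mul, ← ENNReal.ofReal_sum_of_nonneg
            fun i _ => div_nonneg (hw0 _) h0.le, ← Finset.sum_div, div_self h0.ne']
          simp

lemma IsBrownianSheet.lintegral_exp_rect_le_of_uniformContinuous (hW : IsBrownianSheet P d W)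
    (hg : UniformContinuous g) (h1 : ∀ q, |g q| ≤ 1) (c : Fin d) (r : ℝ)
    (x : EuclideanSpace ℝ (Fin d)) {α β a b : ℝ} (hα : 0 ≤ α) (hαβ : α ≤ β) (hβ : β ≤ 1)
    (ha : 0 ≤ a) (hab : a ≤ b) (hb : b ≤ 1) (θ : ℝ) :
    ∫⁻ ω, ENNReal.ofReal (Real.exp (θ * ∫ p, sheetDiff W c r x g p ω ∂(rectMeasure α β a b))) ∂P ≤
      2 * ENNReal.ofReal (Real.exp (72 * (θ ^ 2 * r ^ 2 * ((β - α) * (b - a))))) := by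
  have hgc := hg.continuous
  have hm := mesh_mono hαβ
  set Y : ℕ → Ω → ℝ := fun N ω => ∑ j ∈ Finset.range (N + 1),
    (∫ t in a..b, sheetDiff W c r x g (mesh α β (N + 1) (j + 1), t) ω) *
      (mesh α β (N + 1) (j + 1) - mesh α β (N + 1) j) with hY
  have hYm (N : ℕ) : Measurable (Y N) := by
    have := fun s => hW.measurable_slice hgc.measurable c r x s hab
    fun_prop
  refine lintegral_exp_le_of_tendsto (Y := Y) (S := Y) θ hYm hYm (by simp)
    (ae_of_all _ fun ω => ?_) fun N => ?_
  · have hcd := hW.continuous_sheetDiff hgc c r x ω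
    have hc : Continuous fun s => ∫ t in a..b, sheetDiff W c r x g (s, t) ω :=
      intervalIntegral.continuous_parametric_intervalIntegral_of_continuous' (by fun_prop) _ _
    rw [integral_rectMeasure hcd.measurable (abs_sheetDiff_le h1 c r x · ω)]
    simp only [← intervalIntegral.integral_of_le hαβ, ← intervalIntegral.integral_of_le hab]
    have := tendsto_riemannSum hc hαβ (fun N j => α + (j + 1 : ℕ) * ((β - α) / N))
      fun N i hi => by
        refine ⟨?_, le_rfl⟩
        have : 0 ≤ β - α := by linarith
        gcongr
        simp
    refine (this.comp (tendsto_add_atTop_nat 1)).congr fun N => ?_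
    refine Finset.sum_congr rfl fun i hi => ?_
    have hi' := Finset.mem_range.1 hi
    rw [mesh_eq hα hαβ hβ hi'.le, mesh_eq hα hαβ hβ (Nat.succ_le_of_lt hi')]
    congr 1
    push_cast; ring
  · have := hW.lintegral_exp_sum_slice_le hg h1 c r x ha hab hb (hm (N + 1))
      (fun i => unitClamp_nonneg _) (fun i => unitClamp_le_one _) (N + 1) θ
    refine this.trans (le_of_eq ?_)
    rw [mesh_eq hα hαβ hβ le_rfl, mesh_eq hα hαβ hβ (Nat.zero_le _)]
    have hN : ((N + 1 : ℕ) : ℝ) ≠ 0 := by positivity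
    congr 6
    field_simp
    push_cast
    ring

/-- Exponential moments of the increments of the averaged field. -/
lemma IsBrownianSheet.lintegral_exp_rect_le (hW : IsBrownianSheet P d W)
    (hg : Measurable g) (h1 : ∀ q, |g q| ≤ 1) (c : Fin d) (r : ℝ)
    (x : EuclideanSpace ℝ (Fin d)) {α β a b : ℝ} (hα : 0 ≤ α) (hαβ : α ≤ β) (hβ : β ≤ 1)
    (ha : 0 ≤ a) (hab : a ≤ b) (hb : b ≤ 1) (θ : ℝ) :
    ∫⁻ ω, ENNReal.ofReal (Real.exp (θ * ∫ p, sheetDiff W c r x g p ω ∂(rectMeasure α β a b))) ∂P ≤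
      2 * ENNReal.ofReal (Real.exp (72 * (θ ^ 2 * r ^ 2 * ((β - α) * (b - a))))) := by
  have hWm := hW.measurable_clampedSheet
  set Q := (rectMeasure α β a b).prod P with hQ
  set T₀ : (ℝ × ℝ) × Ω → (ℝ × ℝ) × EuclideanSpace ℝ (Fin d) :=
    fun q => (q.1, clampedSheet W q.1 q.2 + x) with hT₀
  set T₁ : (ℝ × ℝ) × Ω → (ℝ × ℝ) × EuclideanSpace ℝ (Fin d) :=
    fun q => (q.1, clampedSheet W q.1 q.2 + (x + EuclideanSpace.single c r)) with hT₁
  have mT₀ : Measurable T₀ := by fun_prop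
  have mT₁ : Measurable T₁ := by fun_prop
  set μ := Q.map T₀ + Q.map T₁ with hμ
  have hgi : Integrable g μ := Integrable.of_bound hg.aestronglyMeasurable 1 (ae_of_all _ h1)
  have happ (n : ℕ) : ∃ G : (ℝ × ℝ) × EuclideanSpace ℝ (Fin d) → ℝ, UniformContinuous G ∧
      (∀ q, |G q| ≤ 1) ∧ ∫⁻ q, ‖G q - g q‖ₑ ∂μ ≤ ((n : ENNReal) + 1)⁻¹ := by
    obtain ⟨G, hGs, hGle, hGc, -⟩ := hgi.exists_hasCompactSupport_lintegral_sub_le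
      (ε := ((n : ENNReal) + 1)⁻¹) (by simp)
    refine ⟨fun q => max (-1) (min (G q) 1), ?_, fun q => ?_, le_trans ?_ hGle⟩
    · have hu := hGs.uniformContinuous_of_continuous hGc
      have hl : LipschitzWith 1 fun y : ℝ => max (-1) (min y 1) :=
        (LipschitzWith.id.min_const 1).const_max (-1)
      exact hl.uniformContinuous.comp hu
    · exact abs_le.2 ⟨le_max_left _ _, max_le (by norm_num) (min_le_right _ _)⟩
    · refine lintegral_mono fun q => ?_
      rw [Real.enorm_eq_ofReal_abs, Real.enorm_eq_ofReal_abs]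
      refine ENNReal.ofReal_le_ofReal ?_
      have h2 := abs_le.1 (h1 q)
      rw [abs_sub_comm (g q)]
      change |max (-1) (min (G q) 1) - g q| ≤ |G q - g q|
      rcases le_total (G q) 1 with h | h
      · rw [min_eq_left h]
        rcases le_total (-1) (G q) with h' | h'
        · rw [max_eq_right h']
        · rw [max_eq_left h', abs_of_nonpos (by linarith), abs_of_nonpos (by linarith)]
          linarith
      · rw [min_eq_right h, max_eq_right (by norm_num), abs_of_nonneg (by linarith),
          abs_of_nonneg (by linarith)]
        linarith
  choose G hGu hG1 hGle using happ
  have hGm (n : ℕ) : Measurable (G n) := (hGu n).continuous.measurable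
  refine lintegral_exp_le_of_tendsto
    (Y := fun n ω => ∫ p, sheetDiff W c r x (G n) p ω ∂(rectMeasure α β a b))
    (S := fun n ω => ∫ p, sheetDiff W c r x g p ω ∂(rectMeasure α β a b)) θ
    (fun n => hW.measurable_integral_sheetDiff (hGm n) c r x _ _ _ _)
    (fun n => hW.measurable_integral_sheetDiff hg c r x _ _ _ _) ?_
    (ae_of_all _ fun ω => tendsto_const_nhds)
    fun n => hW.lintegral_exp_rect_le_of_uniformContinuous (hGu n) (hG1 n) c r x
      hα hαβ hβ ha hab hb θ
  have hlim : Tendsto (fun n : ℕ => ((n : ENNReal) + 1)⁻¹) atTop (nhds 0) := by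
    have := (ENNReal.tendsto_inv_nat_nhds_zero).comp (tendsto_add_atTop_nat 1)
    simpa [Function.comp_def] using this
  refine tendsto_of_tendsto_of_tendsto_of_le_of_le tendsto_const_nhds hlim (fun n => zero_le)
    fun n => le_trans ?_ (hGle n)
  have hmd (f : (ℝ × ℝ) × EuclideanSpace ℝ (Fin d) → ℝ) (hf : Measurable f) (ω : Ω) :
      Measurable fun p => sheetDiff W c r x f p ω :=
    (hW.measurable_sheetDiff hf c r x).comp measurable_prodMk_right
  set H : (ℝ × ℝ) × EuclideanSpace ℝ (Fin d) → ENNReal := fun q => ‖G n q - g q‖ₑ with hH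
  have hHm : Measurable H := by have := hGm n; fun_prop
  calc _ ≤ ∫⁻ ω, ∫⁻ p, (H (T₀ (p, ω)) + H (T₁ (p, ω))) ∂(rectMeasure α β a b) ∂P := by
        refine lintegral_mono fun ω => ?_
        dsimp only
        rw [← integral_sub
          (integrable_rectMeasure (hmd _ (hGm n) ω) (abs_sheetDiff_le (hG1 n) c r x · ω))
          (integrable_rectMeasure (hmd _ hg ω) (abs_sheetDiff_le h1 c r x · ω))]
        refine (enorm_integral_le_lintegral_enorm _).trans (lintegral_mono fun p => ?_)
        simp only [sheetDiff, hH, hT₀, hT₁]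
        rw [sub_sub_sub_comm]
        exact enorm_sub_le.trans (le_of_eq (add_comm _ _))
    _ = ∫⁻ q, (H (T₀ q) + H (T₁ q)) ∂Q := by
        rw [hQ, lintegral_prod_symm _ (by fun_prop)]
    _ = ∫⁻ q, H q ∂μ := by
        rw [hμ, lintegral_add_measure, lintegral_map hHm mT₀, lintegral_map hHm mT₁,
          lintegral_add_left (by fun_prop)]
    _ ≤ _ := le_rfl

end Rect

section UnionBound

variable {Ω : Type*} [MeasurableSpace Ω] {P : Measure Ω} [IsProbabilityMeasure P]

lemma tsum_ofReal_exp_neg_ne_top :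
    ∑' p : ℕ × ℕ, ENNReal.ofReal (Real.exp (-(p.1 + p.2 + 1 : ℝ))) ≠ ⊤ := by
  have h : Summable fun n : ℕ => Real.exp (-(n : ℝ)) := Real.summable_exp_neg_nat
  have h2 := (h.mul_of_nonneg h (fun _ => (Real.exp_pos _).le)
    fun _ => (Real.exp_pos _).le).mul_left (Real.exp (-1))
  refine (h2.congr fun p => ?_).tsum_ofReal_ne_top
  rw [← Real.exp_add, ← Real.exp_add]
  congr 1
  ring

/-- A union bound over a doubly indexed sequence of finite families of variables. -/
lemma exists_forall_abs_le_of_lintegral_exp_le {ι : Type*} (S : ℕ × ℕ → Finset ι)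
    {Z : ℕ × ℕ → ι → Ω → ℝ} (hZ : ∀ p i, Measurable (Z p i)) {A K : ℝ}
    (hS : ∀ p, ((S p).card : ℝ) ≤ Real.exp (A * (p.1 + p.2 + 1)))
    (hpos : ∀ p, ∀ i ∈ S p, ∫⁻ ω, ENNReal.ofReal (Real.exp (Z p i ω)) ∂P ≤
      2 * ENNReal.ofReal (Real.exp (K * (p.1 + p.2 + 1))))
    (hneg : ∀ p, ∀ i ∈ S p, ∫⁻ ω, ENNReal.ofReal (Real.exp (-Z p i ω)) ∂P ≤
      2 * ENNReal.ofReal (Real.exp (K * (p.1 + p.2 + 1)))) :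
    ∃ (Ω₁ : Set Ω) (C : Ω → ℝ), MeasurableSet Ω₁ ∧ P Ω₁ = 1 ∧ Measurable C ∧ (∀ ω, 0 < C ω) ∧
      ∀ ω ∈ Ω₁, ∀ p, ∀ i ∈ S p, |Z p i ω| ≤ C ω * (p.1 + p.2 + 1) := by
  set q := A + K + 1 with hq
  set φ : ℕ × ℕ → Ω → ENNReal := fun p ω => ENNReal.ofReal (Real.exp (-q * (p.1 + p.2 + 1))) *
    ∑ i ∈ S p, (ENNReal.ofReal (Real.exp (Z p i ω)) + ENNReal.ofReal (Real.exp (-Z p i ω))) with hφ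
  have hφm (p : ℕ × ℕ) : Measurable (φ p) := by
    have := hZ p
    fun_prop
  have hφi (p : ℕ × ℕ) :
      ∫⁻ ω, φ p ω ∂P ≤ 4 * ENNReal.ofReal (Real.exp (-(p.1 + p.2 + 1 : ℝ))) := by
    have hZp := hZ p
    rw [hφ, lintegral_const_mul _ (by fun_prop), lintegral_finsetSum _ fun i _ => by fun_prop]
    have hi (i : ι) (hi : i ∈ S p) : ∫⁻ ω, (ENNReal.ofReal (Real.exp (Z p i ω)) +
        ENNReal.ofReal (Real.exp (-Z p i ω))) ∂P ≤
        4 * ENNReal.ofReal (Real.exp (K * (p.1 + p.2 + 1))) := by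
      rw [lintegral_add_left (by fun_prop)]
      refine (add_le_add (hpos p i hi) (hneg p i hi)).trans (le_of_eq ?_)
      rw [← add_mul]; norm_num
    have hc : ((S p).card : ENNReal) ≤ ENNReal.ofReal (Real.exp (A * (p.1 + p.2 + 1))) := by
      rw [← ENNReal.ofReal_natCast]
      exact ENNReal.ofReal_le_ofReal (hS p)
    calc _ ≤ ENNReal.ofReal (Real.exp (-q * (p.1 + p.2 + 1))) * ∑ i ∈ S p,
          4 * ENNReal.ofReal (Real.exp (K * (p.1 + p.2 + 1))) := by
          gcongr with i h
          exact hi i h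
      _ ≤ ENNReal.ofReal (Real.exp (-q * (p.1 + p.2 + 1))) *
          (ENNReal.ofReal (Real.exp (A * (p.1 + p.2 + 1))) *
            (4 * ENNReal.ofReal (Real.exp (K * (p.1 + p.2 + 1))))) := by
          rw [Finset.sum_const, nsmul_eq_mul]
          gcongr
      _ = 4 * (ENNReal.ofReal (Real.exp (-q * (p.1 + p.2 + 1))) *
          (ENNReal.ofReal (Real.exp (A * (p.1 + p.2 + 1))) *
            ENNReal.ofReal (Real.exp (K * (p.1 + p.2 + 1))))) := by ring
      _ = _ := by
          rw [← ENNReal.ofReal_mul (Real.exp_pos _).le, ← ENNReal.ofReal_mul (Real.exp_pos _).le,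
            ← Real.exp_add, ← Real.exp_add, hq]
          congr 3
          ring
  set Ψ : Ω → ENNReal := fun ω => ∑' p, φ p ω with hΨ
  have hΨm : Measurable Ψ := Measurable.tsum hφm
  have hΨi : ∫⁻ ω, Ψ ω ∂P ≠ ⊤ := by
    rw [hΨ, lintegral_tsum fun p => (hφm p).aemeasurable]
    refine ne_top_of_le_ne_top ?_ (ENNReal.tsum_le_tsum hφi)
    rw [ENNReal.tsum_mul_left]
    exact ENNReal.mul_ne_top (by norm_num) tsum_ofReal_exp_neg_ne_top
  have hΩ : MeasurableSet {ω | Ψ ω < ⊤} := measurableSet_lt hΨm measurable_const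
  refine ⟨{ω | Ψ ω < ⊤}, fun ω => Real.log (1 + (Ψ ω).toReal) + |q| + 1, hΩ,
    (prob_compl_eq_zero_iff hΩ).1 (ae_lt_top hΨm hΨi), ?_, fun ω => ?_, fun ω hω p i hi => ?_⟩
  · have := hΨm.ennreal_toReal
    fun_prop
  · have := Real.log_nonneg (le_add_of_nonneg_right (a := (1 : ℝ))
      (ENNReal.toReal_nonneg (a := Ψ ω)))
    positivity
  have hl : (1 : ℝ) ≤ p.1 + p.2 + 1 := by
    have : (0 : ℝ) ≤ p.1 := Nat.cast_nonneg _
    have : (0 : ℝ) ≤ p.2 := Nat.cast_nonneg _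
    linarith
  set l : ℝ := p.1 + p.2 + 1 with hldef
  have h0 : 0 ≤ Real.log (1 + (Ψ ω).toReal) := Real.log_nonneg (le_add_of_nonneg_right
    ENNReal.toReal_nonneg)
  have h1 : ENNReal.ofReal (Real.exp (-q * l + |Z p i ω|)) ≤ Ψ ω := by
    refine le_trans ?_ (ENNReal.le_tsum p)
    rw [Real.exp_add, ENNReal.ofReal_mul (Real.exp_pos _).le]
    refine mul_le_mul_right (le_trans ?_ (Finset.single_le_sum
      (f := fun i => ENNReal.ofReal (Real.exp (Z p i ω)) + ENNReal.ofReal (Real.exp (-Z p i ω)))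
      (fun _ _ => zero_le) hi)) _
    rcases abs_choice (Z p i ω) with h | h <;> rw [h]
    · exact le_self_add
    · exact le_add_self
  have h2 : Real.exp (-q * l + |Z p i ω|) ≤ 1 + (Ψ ω).toReal := by
    have := (ENNReal.ofReal_le_iff_le_toReal (ne_of_lt hω)).1 h1
    linarith
  have h3 : -q * l + |Z p i ω| ≤ Real.log (1 + (Ψ ω).toReal) :=
    (Real.le_log_iff_exp_le (lt_of_lt_of_le (Real.exp_pos _) h2)).2 h2
  have h4 : q * l ≤ |q| * l := mul_le_mul_of_nonneg_right (le_abs_self q) (by linarith)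
  nlinarith

end UnionBound

section Grid

variable {Ω : Type*} [MeasurableSpace Ω] {P : Measure Ω} [IsProbabilityMeasure P] {d : ℕ}
  {W : ℝ × ℝ → Ω → EuclideanSpace ℝ (Fin d)} {g : (ℝ × ℝ) × EuclideanSpace ℝ (Fin d) → ℝ}

/-- The dyadic cell `I_{nk'} × I_{nk}`, as a measure. -/
def cellMeasure (n k k' : ℕ) : Measure (ℝ × ℝ) :=
  rectMeasure ((k' : ℝ) * (2 : ℝ) ^ (-(n : ℤ))) (((k' : ℝ) + 1) * (2 : ℝ) ^ (-(n : ℤ)))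
    ((k : ℝ) * (2 : ℝ) ^ (-(n : ℤ))) (((k : ℝ) + 1) * (2 : ℝ) ^ (-(n : ℤ)))

/-- The point of level `m` of the dyadic grid with integer coordinates `j`. -/
def gridPt (m : ℕ) (j : Fin d → ℤ) : EuclideanSpace ℝ (Fin d) :=
  WithLp.toLp 2 fun i => (j i : ℝ) / 2 ^ m

/-- The field integrated over a dyadic cell, as a function of the shift. -/
def cellField (W : ℝ × ℝ → Ω → EuclideanSpace ℝ (Fin d))
    (g : (ℝ × ℝ) × EuclideanSpace ℝ (Fin d) → ℝ) (n k k' : ℕ) (ω : Ω)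
    (x : EuclideanSpace ℝ (Fin d)) : ℝ :=
  ∫ p, g (p, clampedSheet W p ω + x) ∂(cellMeasure n k k')

lemma gridPt_add_single (m : ℕ) (j : Fin d → ℤ) (c : Fin d) :
    gridPt m (j + Pi.single c 1) = gridPt m j + EuclideanSpace.single c ((2 : ℝ) ^ m)⁻¹ := by
  ext i
  by_cases h : i = c
  · subst h
    simp [gridPt, add_div]
  · simp [gridPt, h]

lemma cell_bounds {n k : ℕ} (hk : k < 2 ^ n) :
    0 ≤ (k : ℝ) * (2 : ℝ) ^ (-(n : ℤ)) ∧
    (k : ℝ) * (2 : ℝ) ^ (-(n : ℤ)) ≤ ((k : ℝ) + 1) * (2 : ℝ) ^ (-(n : ℤ)) ∧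
    ((k : ℝ) + 1) * (2 : ℝ) ^ (-(n : ℤ)) ≤ 1 := by
  have h : ((k : ℝ) + 1) ≤ 2 ^ n := by exact_mod_cast hk
  refine ⟨by positivity, by gcongr; linarith, ?_⟩
  rw [zpow_neg, zpow_natCast, ← div_eq_mul_inv, div_le_one (by positivity)]
  exact h

omit [IsProbabilityMeasure P] in
lemma IsBrownianSheet.integrable_cell (hW : IsBrownianSheet P d W) (hg : Measurable g)
    (h1 : ∀ q, |g q| ≤ 1) (n k k' : ℕ) (ω : Ω) (x : EuclideanSpace ℝ (Fin d)) :
    Integrable (fun p => g (p, clampedSheet W p ω + x)) (cellMeasure n k k') := by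
  have := (hW.continuous_clampedSheet ω).measurable
  exact integrable_rectMeasure (by fun_prop) fun p => h1 _

omit [IsProbabilityMeasure P] in
lemma IsBrownianSheet.integral_sheetDiff_cell (hW : IsBrownianSheet P d W) (hg : Measurable g)
    (h1 : ∀ q, |g q| ≤ 1) (n k k' : ℕ) (c : Fin d) (r : ℝ) (x : EuclideanSpace ℝ (Fin d)) (ω : Ω) :
    ∫ p, sheetDiff W c r x g p ω ∂(cellMeasure n k k') =
      cellField W g n k k' ω (x + EuclideanSpace.single c r) - cellField W g n k k' ω x :=
  integral_sub (hW.integrable_cell hg h1 n k k' ω _) (hW.integrable_cell hg h1 n k k' ω _)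

lemma IsBrownianSheet.lintegral_exp_cell_le (hW : IsBrownianSheet P d W) (hg : Measurable g)
    (h1 : ∀ q, |g q| ≤ 1) {n k k' : ℕ} (hk : k < 2 ^ n) (hk' : k' < 2 ^ n) (m : ℕ)
    (j : Fin d → ℤ) (c : Fin d) {σ : ℝ} (hσ : σ ^ 2 = 1) :
    ∫⁻ ω, ENNReal.ofReal (Real.exp (σ * (Real.sqrt (n + m + 1) * (2 ^ n * 2 ^ m) *
      (cellField W g n k k' ω (gridPt m (j + Pi.single c 1)) -
        cellField W g n k k' ω (gridPt m j))))) ∂P ≤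
      2 * ENNReal.ofReal (Real.exp (72 * (n + m + 1))) := by
  obtain ⟨a0, a1, a2⟩ := cell_bounds hk
  obtain ⟨b0, b1, b2⟩ := cell_bounds hk'
  have := hW.lintegral_exp_rect_le hg h1 c ((2 : ℝ) ^ m)⁻¹ (gridPt m j) b0 b1 b2 a0 a1 a2
    (σ * (Real.sqrt (n + m + 1) * (2 ^ n * 2 ^ m)))
  refine le_trans (le_of_eq ?_) (this.trans (le_of_eq ?_))
  · refine lintegral_congr fun ω => ?_
    rw [gridPt_add_single, ← hW.integral_sheetDiff_cell hg h1, ← mul_assoc]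
    rfl
  · congr 4
    rw [mul_pow, hσ, mul_pow, Real.sq_sqrt (by positivity), zpow_neg, zpow_natCast]
    field_simp
    ring

/-- Almost sure control of all the nearest-neighbour increments on the dyadic grids. -/
lemma IsBrownianSheet.exists_forall_abs_cellField_sub_le (hW : IsBrownianSheet P d W)
    (hg : Measurable g) (h1 : ∀ q, |g q| ≤ 1) :
    ∃ (Ω₁ : Set Ω) (C : Ω → ℝ), MeasurableSet Ω₁ ∧ P Ω₁ = 1 ∧ Measurable C ∧ (∀ ω, 0 < C ω) ∧
      ∀ ω ∈ Ω₁, ∀ n k k' : ℕ, k < 2 ^ n → k' < 2 ^ n → ∀ (m : ℕ) (j : Fin d → ℤ) (c : Fin d),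
        (∀ i, |j i| ≤ 2 ^ m) →
        |cellField W g n k k' ω (gridPt m (j + Pi.single c 1)) -
          cellField W g n k k' ω (gridPt m j)| ≤
          C ω * (Real.sqrt (n + m + 1) / (2 ^ n * 2 ^ m)) := by
  set S : ℕ × ℕ → Finset (ℕ × ℕ × (Fin d → ℤ) × Fin d) := fun p =>
    Finset.range (2 ^ p.1) ×ˢ Finset.range (2 ^ p.1) ×ˢ
      (Fintype.piFinset fun _ => Finset.Icc (-2 ^ p.2) (2 ^ p.2)) ×ˢ Finset.univ with hS
  set Z : ℕ × ℕ → ℕ × ℕ × (Fin d → ℤ) × Fin d → Ω → ℝ := fun p i ω =>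
    Real.sqrt (p.1 + p.2 + 1) * (2 ^ p.1 * 2 ^ p.2) *
      (cellField W g p.1 i.1 i.2.1 ω (gridPt p.2 (i.2.2.1 + Pi.single i.2.2.2 1)) -
        cellField W g p.1 i.1 i.2.1 ω (gridPt p.2 i.2.2.1)) with hZ
  have hZm (p : ℕ × ℕ) (i : ℕ × ℕ × (Fin d → ℤ) × Fin d) : Measurable (Z p i) := by
    have := hW.measurable_integral_sheetDiff hg i.2.2.2 ((2 : ℝ) ^ p.2)⁻¹ (gridPt p.2 i.2.2.1)
      ((i.2.1 : ℝ) * (2 : ℝ) ^ (-(p.1 : ℤ))) (((i.2.1 : ℝ) + 1) * (2 : ℝ) ^ (-(p.1 : ℤ)))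
      ((i.1 : ℝ) * (2 : ℝ) ^ (-(p.1 : ℤ))) (((i.1 : ℝ) + 1) * (2 : ℝ) ^ (-(p.1 : ℤ)))
    refine Measurable.const_mul ?_ _
    simp only [gridPt_add_single, ← hW.integral_sheetDiff_cell hg h1]
    exact this
  have hSc (p : ℕ × ℕ) : ((S p).card : ℝ) ≤ Real.exp ((4 + 4 * d) * (p.1 + p.2 + 1)) := by
    have hcard : (S p).card = 2 ^ p.1 * (2 ^ p.1 * ((2 ^ p.2 + 1 + 2 ^ p.2) ^ d * d)) := by
      simp only [hS, Finset.card_product, Finset.card_range, Fintype.card_piFinset, Int.card_Icc,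
        Finset.prod_const, Finset.card_univ, Fintype.card_fin]
      congr 4
      zify
      have : (0 : ℤ) < 2 ^ p.2 := by positivity
      rw [Int.toNat_of_nonneg (by linarith)]
      ring
    have e2 : (2 : ℝ) ≤ Real.exp 1 := by
      have := Real.add_one_le_exp (1 : ℝ); linarith
    have p2 (a : ℕ) : (2 : ℝ) ^ a ≤ Real.exp a := by
      calc (2 : ℝ) ^ a ≤ Real.exp 1 ^ a := by gcongr
        _ = Real.exp a := by rw [← Real.exp_nat_mul, mul_one]
    have hd : (d : ℝ) ≤ Real.exp d := by
      have := Real.add_one_le_exp (d : ℝ); linarith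
    have h3 : ((2 : ℝ) ^ p.2 + 1 + 2 ^ p.2) ≤ Real.exp (p.2 + 2) := by
      have : (1 : ℝ) ≤ 2 ^ p.2 := one_le_pow₀ (by norm_num)
      calc ((2 : ℝ) ^ p.2 + 1 + 2 ^ p.2) ≤ 2 ^ (p.2 + 2) := by rw [pow_add]; linarith
        _ ≤ _ := by have := p2 (p.2 + 2); push_cast at this; exact this
    rw [hcard]
    push_cast
    calc _ ≤ Real.exp p.1 * (Real.exp p.1 * (Real.exp (p.2 + 2) ^ d * Real.exp d)) := by
          gcongr
          · exact p2 _
          · exact p2 _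
      _ = Real.exp (p.1 + (p.1 + (d * (p.2 + 2) + d))) := by
          rw [← Real.exp_nat_mul, Real.exp_add, Real.exp_add, Real.exp_add]
      _ ≤ _ := by
          refine Real.exp_le_exp.2 ?_
          have h1 : (0 : ℝ) ≤ p.1 := Nat.cast_nonneg _
          have h2 : (0 : ℝ) ≤ p.2 := Nat.cast_nonneg _
          have h3 : (0 : ℝ) ≤ d := Nat.cast_nonneg _
          nlinarith [mul_nonneg h3 h1, mul_nonneg h3 h2]
  have hmem (p : ℕ × ℕ) (i : ℕ × ℕ × (Fin d → ℤ) × Fin d) : i ∈ S p ↔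
      i.1 < 2 ^ p.1 ∧ i.2.1 < 2 ^ p.1 ∧ ∀ l, |i.2.2.1 l| ≤ 2 ^ p.2 := by
    simp [hS, abs_le]
  obtain ⟨Ω₁, C, hΩ, hP, hC, hC0, h⟩ := exists_forall_abs_le_of_lintegral_exp_le (P := P) S hZm
    (K := 72) hSc (fun p i hi => by
      have hi' := (hmem p i).1 hi
      simpa only [one_mul] using
        hW.lintegral_exp_cell_le hg h1 hi'.1 hi'.2.1 p.2 i.2.2.1 i.2.2.2 (σ := 1) (by norm_num))
    (fun p i hi => by
      have hi' := (hmem p i).1 hi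
      simpa only [neg_mul, one_mul] using
        hW.lintegral_exp_cell_le hg h1 hi'.1 hi'.2.1 p.2 i.2.2.1 i.2.2.2 (σ := -1) (by norm_num))
  refine ⟨Ω₁, C, hΩ, hP, hC, hC0, fun ω hω n k k' hk hk' m j c hj => ?_⟩
  have := h ω hω (n, m) (k, k', j, c) ((hmem _ _).2 ⟨hk, hk', hj⟩)
  simp only [hZ, abs_mul] at this
  have hs : 0 < Real.sqrt ((n : ℝ) + m + 1) := Real.sqrt_pos.2 (by positivity)
  rw [abs_of_pos hs, abs_of_pos (by positivity : (0 : ℝ) < 2 ^ n),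
    abs_of_pos (by positivity : (0 : ℝ) < 2 ^ m)] at this
  rw [← mul_div_assoc, le_div_iff₀ (by positivity)]
  refine le_of_mul_le_mul_left ?_ hs
  have hq := Real.mul_self_sqrt (by positivity : 0 ≤ (n : ℝ) + m + 1)
  calc _ = _ := by ring
    _ ≤ _ := this
    _ = C ω * (Real.sqrt (n + m + 1) * Real.sqrt (n + m + 1)) := by rw [hq]
    _ = _ := by ring

end Grid

section Chaining

variable {d : ℕ} {f : EuclideanSpace ℝ (Fin d) → ℝ}

/-- The coordinatewise integer part of `x` at dyadic level `m`. -/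
def gridFloor (m : ℕ) (x : EuclideanSpace ℝ (Fin d)) : Fin d → ℤ := fun i => ⌊x i * 2 ^ m⌋

lemma abs_gridFloor_le {x : EuclideanSpace ℝ (Fin d)} (hx : ∀ i, |x i| ≤ 1) (m : ℕ) (i : Fin d) :
    |gridFloor m x i| ≤ 2 ^ m := by
  have h := abs_le.1 (hx i)
  have hp : (0 : ℝ) < 2 ^ m := by positivity
  refine abs_le.2 ⟨Int.le_floor.2 ?_, ?_⟩
  · push_cast; nlinarith
  · have h2 : x i * 2 ^ m ≤ ((2 ^ m : ℤ) : ℝ) := by push_cast; nlinarith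
    have := Int.floor_mono h2
    rwa [Int.floor_intCast] at this

lemma gridPt_two_mul (m : ℕ) (j : Fin d → ℤ) : gridPt (m + 1) (fun i => 2 * j i) = gridPt m j := by
  ext i
  simp only [gridPt, pow_succ]
  push_cast
  field_simp

lemma abs_gridFloor_succ_sub_le (m : ℕ) (x : EuclideanSpace ℝ (Fin d)) (i : Fin d) :
    |gridFloor (m + 1) x i - 2 * gridFloor m x i| ≤ 1 := by
  unfold gridFloor
  have e : x i * 2 ^ (m + 1) = 2 * (x i * 2 ^ m) := by ring
  rw [e]
  have h1 := Int.floor_le (x i * 2 ^ m)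
  have h2 := Int.lt_floor_add_one (x i * 2 ^ m)
  have h3 : 2 * ⌊x i * 2 ^ m⌋ ≤ ⌊2 * (x i * 2 ^ m)⌋ := Int.le_floor.2 (by push_cast; linarith)
  have h4 : ⌊2 * (x i * 2 ^ m)⌋ < 2 * ⌊x i * 2 ^ m⌋ + 2 :=
    Int.floor_lt.2 (by push_cast; linarith)
  exact abs_le.2 ⟨by linarith, by linarith⟩

lemma abs_gridFloor_sub_le {m : ℕ} {x y : EuclideanSpace ℝ (Fin d)}
    (h : ‖x - y‖ ≤ (2 ^ m : ℝ)⁻¹) (i : Fin d) :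
    |gridFloor m x i - gridFloor m y i| ≤ 1 := by
  unfold gridFloor
  have hp : (0 : ℝ) < 2 ^ m := by positivity
  have h0 : |x i - y i| ≤ (2 ^ m : ℝ)⁻¹ := le_trans (PiLp.norm_apply_le (x - y) i) h
  have h1 : |x i * 2 ^ m - y i * 2 ^ m| ≤ 1 := by
    rw [← sub_mul, abs_mul, abs_of_pos hp]
    calc _ ≤ (2 ^ m : ℝ)⁻¹ * 2 ^ m := by gcongr
      _ = 1 := inv_mul_cancel₀ hp.ne'
  obtain ⟨h2, h3⟩ := abs_le.1 h1
  have a1 := Int.floor_le (x i * 2 ^ m)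
  have a2 := Int.lt_floor_add_one (x i * 2 ^ m)
  have b1 := Int.floor_le (y i * 2 ^ m)
  have b2 := Int.lt_floor_add_one (y i * 2 ^ m)
  have c1 : ⌊x i * 2 ^ m⌋ < ⌊y i * 2 ^ m⌋ + 2 := by
    exact_mod_cast (by push_cast; linarith :
      ((⌊x i * 2 ^ m⌋ : ℤ) : ℝ) < ((⌊y i * 2 ^ m⌋ + 2 : ℤ) : ℝ))
  have c2 : ⌊y i * 2 ^ m⌋ < ⌊x i * 2 ^ m⌋ + 2 := by
    exact_mod_cast (by push_cast; linarith :
      ((⌊y i * 2 ^ m⌋ : ℤ) : ℝ) < ((⌊x i * 2 ^ m⌋ + 2 : ℤ) : ℝ))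
  exact abs_le.2 ⟨by linarith, by linarith⟩

lemma exists_gridPt_gridFloor_eq {x : EuclideanSpace ℝ (Fin d)} (hx : IsDyadicPoint x) :
    ∃ M, ∀ m, M ≤ m → gridPt m (gridFloor m x) = x := by
  choose a l h using hx
  refine ⟨∑ i, l i, fun m hm => ?_⟩
  ext i
  have hl : l i ≤ m := (Finset.single_le_sum (f := l) (fun _ _ => Nat.zero_le _)
    (Finset.mem_univ i)).trans hm
  obtain ⟨t, rfl⟩ := Nat.exists_eq_add_of_le hl
  have e : x i * 2 ^ (l i + t) = ((a i * 2 ^ t : ℤ) : ℝ) := by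
    rw [h, pow_add]; push_cast; field_simp
  simp only [gridPt, gridFloor]
  rw [e, Int.floor_intCast, ← e]
  field_simp

/-- A one-coordinate move on the grid. -/
lemma abs_sub_update_le {m : ℕ} {B : ℝ} (hB : 0 ≤ B)
    (hf : ∀ (j : Fin d → ℤ) (c : Fin d), (∀ i, |j i| ≤ 2 ^ m) →
      |f (gridPt m (j + Pi.single c 1)) - f (gridPt m j)| ≤ B)
    {j : Fin d → ℤ} (hj : ∀ i, |j i| ≤ 2 ^ m) {c : Fin d} {z : ℤ} (hz : |z| ≤ 2 ^ m)
    (hzj : |z - j c| ≤ 1) :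
    |f (gridPt m (Function.update j c z)) - f (gridPt m j)| ≤ B := by
  have h3 : z - j c = -1 ∨ z - j c = 0 ∨ z - j c = 1 := by
    have := abs_le.1 hzj
    omega
  rcases h3 with h | h | h
  · have e : Function.update j c z + Pi.single c 1 = j := by
      ext i
      by_cases hi : i = c
      · subst hi; simp; omega
      · simp [hi]
    have := hf (Function.update j c z) c fun i => by
      by_cases hi : i = c
      · subst hi; simpa using hz
      · simpa [hi] using hj i
    rw [e] at this
    rwa [abs_sub_comm]
  · rw [sub_eq_zero.1 h, Function.update_eq_self, sub_self, abs_zero]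
    exact hB
  · have e : Function.update j c z = j + Pi.single c 1 := by
      ext i
      by_cases hi : i = c
      · subst hi; simp; omega
      · simp [hi]
    rw [e]
    exact hf j c hj

lemma abs_sub_gridPt_le {m : ℕ} {B : ℝ} (hB : 0 ≤ B)
    (hf : ∀ (j : Fin d → ℤ) (c : Fin d), (∀ i, |j i| ≤ 2 ^ m) →
      |f (gridPt m (j + Pi.single c 1)) - f (gridPt m j)| ≤ B)
    {j j' : Fin d → ℤ} (hj : ∀ i, |j i| ≤ 2 ^ m) (hj' : ∀ i, |j' i| ≤ 2 ^ m)
    (h : ∀ i, |j' i - j i| ≤ 1) :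
    |f (gridPt m j') - f (gridPt m j)| ≤ d * B := by
  have key (s : Finset (Fin d)) :
      |f (gridPt m (s.piecewise j' j)) - f (gridPt m j)| ≤ s.card * B := by
    induction s using Finset.induction_on with
    | empty => simp
    | insert a s ha ih =>
      have h1 : ∀ i, |s.piecewise j' j i| ≤ 2 ^ m := fun i => by
        by_cases hi : i ∈ s
        · simpa [hi] using hj' i
        · simpa [hi] using hj i
      have h2 := abs_sub_update_le hB hf h1 (c := a) (hj' a) (by simpa [ha] using h a)
      rw [Finset.piecewise_insert, Finset.card_insert_of_notMem ha]
      refine (abs_sub_le _ (f (gridPt m (s.piecewise j' j))) _).trans ?_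
      push_cast
      linarith
  simpa using key Finset.univ

/-- The size of the nearest-neighbour increments at level `m`. -/
def gridScale (C : ℝ) (n m : ℕ) : ℝ := C * (Real.sqrt (n + m + 1) / (2 ^ n * 2 ^ m))

lemma gridScale_nonneg {C : ℝ} (hC : 0 ≤ C) (n m : ℕ) : 0 ≤ gridScale C n m := by
  unfold gridScale; positivity

lemma gridScale_succ_le {C : ℝ} (hC : 0 ≤ C) {n : ℕ} (hn : 1 ≤ n) (m : ℕ) :
    gridScale C n (m + 1) ≤ 5 / 8 * gridScale C n m := by
  have h1 : (1 : ℝ) ≤ n := by exact_mod_cast hn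
  have h2 : (0 : ℝ) ≤ m := Nat.cast_nonneg _
  have h : Real.sqrt (n + (m + 1 : ℕ) + 1) ≤ 5 / 4 * Real.sqrt (n + m + 1) := by
    rw [Real.sqrt_le_left (by positivity), mul_pow, Real.sq_sqrt (by positivity)]
    push_cast
    linarith
  unfold gridScale
  calc _ ≤ C * (5 / 4 * Real.sqrt (n + m + 1) / (2 ^ n * 2 ^ (m + 1))) := by gcongr
    _ = _ := by rw [pow_succ]; field_simp; ring

lemma abs_sub_gridFloor_le {C : ℝ} (hC : 0 ≤ C) {n : ℕ} (hn : 1 ≤ n)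
    (hf : ∀ (m : ℕ) (j : Fin d → ℤ) (c : Fin d), (∀ i, |j i| ≤ 2 ^ m) →
      |f (gridPt m (j + Pi.single c 1)) - f (gridPt m j)| ≤ gridScale C n m)
    {x : EuclideanSpace ℝ (Fin d)} (hx : ∀ i, |x i| ≤ 1) (t m : ℕ) :
    |f (gridPt (m + t) (gridFloor (m + t) x)) - f (gridPt m (gridFloor m x))| ≤
      2 * (d * gridScale C n m) := by
  induction t generalizing m with
  | zero =>
    have := gridScale_nonneg hC n m
    simp only [add_zero, sub_self, abs_zero]
    positivity
  | succ t ih =>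
    have h1 := ih (m + 1)
    have h2 := abs_sub_gridPt_le (gridScale_nonneg hC n (m + 1)) (hf (m + 1))
      (j := fun i => 2 * gridFloor m x i) (j' := gridFloor (m + 1) x)
      (fun i => by
        have := abs_gridFloor_le hx m i
        rw [abs_mul, pow_succ, abs_of_pos (by norm_num)]; linarith)
      (abs_gridFloor_le hx (m + 1)) (abs_gridFloor_succ_sub_le m x)
    rw [gridPt_two_mul] at h2
    have h3 := mul_le_mul_of_nonneg_left (gridScale_succ_le hC hn m) (Nat.cast_nonneg (α := ℝ) d)
    have h4 := mul_nonneg (Nat.cast_nonneg (α := ℝ) d) (gridScale_nonneg hC n m)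
    rw [show m + (t + 1) = m + 1 + t by ring]
    refine (abs_sub_le _ (f (gridPt (m + 1) (gridFloor (m + 1) x))) _).trans ?_
    linarith

lemma abs_sub_le_gridScale {C : ℝ} (hC : 0 ≤ C) {n : ℕ} (hn : 1 ≤ n)
    (hf : ∀ (m : ℕ) (j : Fin d → ℤ) (c : Fin d), (∀ i, |j i| ≤ 2 ^ m) →
      |f (gridPt m (j + Pi.single c 1)) - f (gridPt m j)| ≤ gridScale C n m)
    {x y : EuclideanSpace ℝ (Fin d)} (hxd : IsDyadicPoint x) (hyd : IsDyadicPoint y)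
    (hx : ∀ i, |x i| ≤ 1) (hy : ∀ i, |y i| ≤ 1) {m : ℕ} (h : ‖x - y‖ ≤ (2 ^ m : ℝ)⁻¹) :
    |f x - f y| ≤ 5 * (d * gridScale C n m) := by
  have key {z : EuclideanSpace ℝ (Fin d)} (hzd : IsDyadicPoint z) (hz : ∀ i, |z i| ≤ 1) :
      |f z - f (gridPt m (gridFloor m z))| ≤ 2 * (d * gridScale C n m) := by
    obtain ⟨M, hM⟩ := exists_gridPt_gridFloor_eq hzd
    have := abs_sub_gridFloor_le hC hn hf hz M m
    rwa [hM _ (Nat.le_add_left _ _)] at this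
  have h1 := abs_le.1 (key hxd hx)
  have h2 := abs_le.1 (key hyd hy)
  have h3 := abs_le.1 (abs_sub_gridPt_le (gridScale_nonneg hC n m) (hf m) (abs_gridFloor_le hy m)
    (abs_gridFloor_le hx m) (abs_gridFloor_sub_le h))
  exact abs_le.2 ⟨by linarith [h1.1, h2.2, h3.1], by linarith [h1.2, h2.1, h3.2]⟩

/-- Chaining: control of nearest-neighbour increments on all dyadic grids yields a modulus of
continuity on dyadic points. -/
lemma abs_sub_le_of_gridScale {C : ℝ} (hC : 0 ≤ C) {n : ℕ} (hn : 1 ≤ n)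
    (hf : ∀ (m : ℕ) (j : Fin d → ℤ) (c : Fin d), (∀ i, |j i| ≤ 2 ^ m) →
      |f (gridPt m (j + Pi.single c 1)) - f (gridPt m j)| ≤ gridScale C n m)
    (hfb : ∀ x y, |f x - f y| ≤ 2 * (2 : ℝ) ^ (-(n : ℤ)))
    {x y : EuclideanSpace ℝ (Fin d)} (hxd : IsDyadicPoint x) (hyd : IsDyadicPoint y)
    (hx : ∀ i, |x i| ≤ 1) (hy : ∀ i, |y i| ≤ 1) :
    |f x - f y| ≤ (20 * d * C + 2) * (2 : ℝ) ^ (-(n : ℤ)) *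
      (Real.sqrt n + Real.sqrt (max (Real.log (1 / ‖x - y‖)) 0)) * ‖x - y‖ := by
  have hn1 : (1 : ℝ) ≤ n := by exact_mod_cast hn
  have hsn : 1 ≤ Real.sqrt n := Real.one_le_sqrt.2 hn1
  have hz : (0 : ℝ) < (2 : ℝ) ^ (-(n : ℤ)) := by positivity
  set D := ‖x - y‖ with hD
  set L := Real.sqrt (max (Real.log (1 / D)) 0) with hL
  have hL0 : 0 ≤ L := Real.sqrt_nonneg _
  have hdC : 0 ≤ d * C := by positivity
  rcases (norm_nonneg (x - y)).eq_or_lt with h0 | h0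
  · have : x = y := sub_eq_zero.1 (norm_eq_zero.1 h0.symm)
    simp [this, hD]
  rw [← hD] at h0
  rcases lt_or_ge 1 D with h1 | h1
  · refine (hfb x y).trans ?_
    have a1 : 1 ≤ (Real.sqrt n + L) * D := by nlinarith
    calc 2 * (2 : ℝ) ^ (-(n : ℤ)) = 2 * (2 : ℝ) ^ (-(n : ℤ)) * 1 := by ring
      _ ≤ (20 * d * C + 2) * (2 : ℝ) ^ (-(n : ℤ)) * ((Real.sqrt n + L) * D) := by
        gcongr
        nlinarith
      _ = _ := by ring
  · obtain ⟨m, hm1, hm2⟩ := exists_nat_pow_near_of_lt_one h0 h1 (by norm_num : (0 : ℝ) < 1 / 2)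
      (by norm_num)
    have hm2' : D ≤ (2 ^ m : ℝ)⁻¹ := by simpa using hm2
    have hm1' : (2 ^ m : ℝ)⁻¹ ≤ 2 * D := by
      rw [pow_succ, one_div, inv_pow] at hm1
      linarith
    have hlog : (m : ℝ) ≤ 2 * Real.log (1 / D) := by
      have a : (m : ℝ) * Real.log 2 ≤ Real.log (1 / D) := by
        rw [← Real.log_pow]
        refine Real.log_le_log (by positivity) ?_
        rw [le_div_iff₀ h0]
        calc _ ≤ (2 : ℝ) ^ m * (2 ^ m)⁻¹ := by gcongr
          _ = 1 := mul_inv_cancel₀ (by positivity)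
      have b := Real.log_two_gt_d9
      nlinarith [Nat.cast_nonneg (α := ℝ) m]
    have hmL : (m : ℝ) ≤ 2 * L ^ 2 := by
      rw [hL, Real.sq_sqrt (le_max_right _ _)]
      linarith [le_max_left (Real.log (1 / D)) 0]
    have hs : Real.sqrt (n + m + 1) ≤ 2 * (Real.sqrt n + L) := by
      rw [Real.sqrt_le_left (by positivity)]
      nlinarith [Real.sq_sqrt (Nat.cast_nonneg (α := ℝ) n), mul_nonneg (Real.sqrt_nonneg n) hL0]
    refine (abs_sub_le_gridScale hC hn hf hxd hyd hx hy hm2').trans ?_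
    have e : gridScale C n m = C * ((2 : ℝ) ^ (-(n : ℤ)) * (Real.sqrt (n + m + 1) * (2 ^ m)⁻¹)) := by
      unfold gridScale
      rw [zpow_neg, zpow_natCast]
      field_simp
    rw [e]
    calc _ = 5 * (d * C) * ((2 : ℝ) ^ (-(n : ℤ)) * (Real.sqrt (n + m + 1) * (2 ^ m)⁻¹)) := by ring
      _ ≤ 5 * (d * C) * ((2 : ℝ) ^ (-(n : ℤ)) * (2 * (Real.sqrt n + L) * (2 * D))) := by gcongr
      _ ≤ 5 * (d * C) * ((2 : ℝ) ^ (-(n : ℤ)) * (2 * (Real.sqrt n + L) * (2 * D))) +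
          2 * ((2 : ℝ) ^ (-(n : ℤ)) * (Real.sqrt n + L) * D) :=
          le_add_of_nonneg_right (by positivity)
      _ = _ := by ring

end Chaining

section Final

variable {Ω : Type*} [MeasurableSpace Ω] {P : Measure Ω} [IsProbabilityMeasure P] {d : ℕ}
  {W : ℝ × ℝ → Ω → EuclideanSpace ℝ (Fin d)} {g : (ℝ × ℝ) × EuclideanSpace ℝ (Fin d) → ℝ}

lemma measureReal_cellMeasure_le (n k k' : ℕ) :
    (cellMeasure n k k').real univ ≤ (2 : ℝ) ^ (-(n : ℤ)) := by
  have h1 : (2 : ℝ) ^ (-(n : ℤ)) ≤ 1 := by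
    rw [zpow_neg, zpow_natCast]
    exact inv_le_one_of_one_le₀ (one_le_pow₀ (by norm_num))
  have h0 : (0 : ℝ) < (2 : ℝ) ^ (-(n : ℤ)) := by positivity
  have e : (cellMeasure n k k').real univ = (2 : ℝ) ^ (-(n : ℤ)) * (2 : ℝ) ^ (-(n : ℤ)) := by
    unfold cellMeasure rectMeasure
    rw [← univ_prod_univ, measureReal_prod_prod]
    simp only [measureReal_restrict_apply_univ, Real.volume_real_Ioc]
    rw [add_mul, add_mul, add_sub_cancel_left, add_sub_cancel_left, one_mul, max_eq_left h0.le]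
  rw [e]
  nlinarith

omit [MeasurableSpace Ω] in
lemma abs_cellField_sub_le (h1 : ∀ q, |g q| ≤ 1) (n k k' : ℕ) (ω : Ω)
    (x y : EuclideanSpace ℝ (Fin d)) :
    |cellField W g n k k' ω x - cellField W g n k k' ω y| ≤ 2 * (2 : ℝ) ^ (-(n : ℤ)) := by
  have key (x : EuclideanSpace ℝ (Fin d)) : |cellField W g n k k' ω x| ≤ (2 : ℝ) ^ (-(n : ℤ)) := by
    have : IsFiniteMeasure (cellMeasure n k k') := by unfold cellMeasure; infer_instance
    have := norm_integral_le_of_norm_le_const (μ := cellMeasure n k k')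
      (f := fun p => g (p, clampedSheet W p ω + x)) (ae_of_all _ fun p => h1 _)
    rw [one_mul] at this
    exact this.trans (measureReal_cellMeasure_le n k k')
  have := key x
  have := key y
  have := abs_sub (cellField W g n k k' ω x) (cellField W g n k k' ω y)
  linarith

omit [IsProbabilityMeasure P] in
lemma IsBrownianSheet.cellField_sub_eq (hW : IsBrownianSheet P d W) (hg : Measurable g)
    (h1 : ∀ q, |g q| ≤ 1) {n k k' : ℕ} (hk : k < 2 ^ n) (hk' : k' < 2 ^ n) (ω : Ω)
    (x y : EuclideanSpace ℝ (Fin d)) :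
    cellField W g n k k' ω x - cellField W g n k k' ω y =
      ∫ s in Set.Ioc ((k' : ℝ) * (2:ℝ) ^ (-(n:ℤ))) (((k' : ℝ) + 1) * (2:ℝ) ^ (-(n:ℤ))),
        ∫ t in Set.Ioc ((k : ℝ) * (2:ℝ) ^ (-(n:ℤ))) (((k : ℝ) + 1) * (2:ℝ) ^ (-(n:ℤ))),
          (g ((s, t), W (s, t) ω + x) - g ((s, t), W (s, t) ω + y)) := by
  have hWm := (hW.continuous_clampedSheet ω).measurable
  obtain ⟨a0, -, a2⟩ := cell_bounds hk
  obtain ⟨b0, -, b2⟩ := cell_bounds hk'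
  unfold cellField
  rw [← integral_sub (hW.integrable_cell hg h1 n k k' ω _) (hW.integrable_cell hg h1 n k k' ω _)]
  unfold cellMeasure
  rw [integral_rectMeasure (by fun_prop) (C := 2) fun p => (abs_sub _ _).trans
    (by linarith [h1 (p, clampedSheet W p ω + x), h1 (p, clampedSheet W p ω + y)])]
  refine setIntegral_congr_fun measurableSet_Ioc fun s hs =>
    setIntegral_congr_fun measurableSet_Ioc fun t ht => ?_
  have hmem : ((s, t) : ℝ × ℝ) ∈ Set.Icc (0 : ℝ × ℝ) 1 :=
    ⟨⟨b0.trans hs.1.le, a0.trans ht.1.le⟩, ⟨hs.2.trans b2, ht.2.trans a2⟩⟩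
  simp only [clampedSheet, squareClamp_eq_self hmem]

end Final

/-- a.s. estimate for `ϱ_{nkk'}(x,y)` over dyadic points of `[-1,1]^d`. -/
theorem statement8 {Ω : Type*} [MeasurableSpace Ω] (P : Measure Ω) [IsProbabilityMeasure P]
    (d : ℕ) (W : ℝ × ℝ → Ω → EuclideanSpace ℝ (Fin d)) (hW : IsBrownianSheet P d W)
    (b : ℝ × ℝ → EuclideanSpace ℝ (Fin d) → ℝ)
    (hmeas : Measurable fun q : (ℝ × ℝ) × EuclideanSpace ℝ (Fin d) => b q.1 q.2)
    (hbdd : ∀ p x, |b p x| ≤ 1) :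
    ∃ (Ω₁ : Set Ω) (C₁ : Ω → ℝ), MeasurableSet Ω₁ ∧ P Ω₁ = 1 ∧
      Measurable C₁ ∧ (∀ ω, 0 < C₁ ω) ∧
      ∀ ω ∈ Ω₁, ∀ x y : EuclideanSpace ℝ (Fin d),
        IsDyadicPoint x → IsDyadicPoint y →
        (∀ i, |x i| ≤ 1) → (∀ i, |y i| ≤ 1) →
        ∀ n k k' : ℕ, 1 ≤ n → k ≤ 2 ^ n - 1 → k' ≤ 2 ^ n - 1 →
          |∫ s in Set.Ioc ((k' : ℝ) * (2:ℝ) ^ (-(n:ℤ))) (((k' : ℝ) + 1) * (2:ℝ) ^ (-(n:ℤ))),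
             ∫ t in Set.Ioc ((k : ℝ) * (2:ℝ) ^ (-(n:ℤ))) (((k : ℝ) + 1) * (2:ℝ) ^ (-(n:ℤ))),
               (b (s, t) (W (s, t) ω + x) - b (s, t) (W (s, t) ω + y))|
            ≤ C₁ ω * (2:ℝ) ^ (-(n:ℤ)) *
                (Real.sqrt n + Real.sqrt (max (Real.log (1 / ‖x - y‖)) 0)) * ‖x - y‖ := by
  set g : (ℝ × ℝ) × EuclideanSpace ℝ (Fin d) → ℝ := fun q => b q.1 q.2 with hg
  have h1 : ∀ q, |g q| ≤ 1 := fun q => hbdd q.1 q.2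
  obtain ⟨Ω₁, C, hΩ, hP, hC, hC0, h⟩ := hW.exists_forall_abs_cellField_sub_le hmeas h1
  refine ⟨Ω₁, fun ω => 20 * d * C ω + 2, hΩ, hP, by fun_prop, fun ω => ?_,
    fun ω hω x y hxd hyd hx hy n k k' hn hk hk' => ?_⟩
  · have := hC0 ω
    positivity
  have hp : 0 < 2 ^ n := by positivity
  have hk2 : k < 2 ^ n := by omega
  have hk2' : k' < 2 ^ n := by omega
  rw [← hW.cellField_sub_eq hmeas h1 hk2 hk2' ω x y]
  exact abs_sub_le_of_gridScale (hC0 ω).le hn (h ω hω n k k' hk2 hk2')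
    (abs_cellField_sub_le h1 n k k' ω) hxd hyd hx hy
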